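/- arXiv:2008.12045 — 3 statements merged into one kernel-verified Lean document; each statement's English description precedes it below -/
import Mathlib

section
/- Let n ≥ 3 be an integer, R > 0 and ε ∈ (0,R). Set τ = R·arccos(ε/R) and κ = 1/2 + π/(4·arccos(ε/R)). Then there exist ρ ∈ (0,R), a real number ℓ with ℓ − 1 > κ·τ, and a smooth function f : [τ,ℓ] → ℝ with f > 0 and |f'| ≤ 1 throughout, such that: (i) f(r) = R·cos(r/R) for all r ∈ [τ, κ·τ]; (ii) f(r) = ρ for all r ∈ [ℓ−1, ℓ]; and (iii) for every r ∈ [τ,ℓ], min((n−2)(1−f'(r)²)/f(r)² − n·f''(r)/f(r), 2(n−2)(1−f'(r)²)/f(r)² − 2·f''(r)/f(r)) > 0. -/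
theorem hasDerivAt_real_tanh (x : ℝ) : HasDerivAt Real.tanh (1 - Real.tanh x ^ 2) x := by
  have h := (Real.hasDerivAt_sinh x).div (Real.hasDerivAt_cosh x) (Real.cosh_pos x).ne'
  have e : Real.tanh = Real.sinh / Real.cosh := by
    funext y
    exact Real.tanh_eq_sinh_div_cosh y
  rw [e]
  refine h.congr_deriv ?_
  rw [Pi.div_apply]
  have := (Real.cosh_pos x).ne'
  field_simp

theorem contDiff_real_tanh : ContDiff ℝ (⊤ : ℕ∞) Real.tanh := by
  have e : Real.tanh = fun x => Real.sinh x / Real.cosh x := by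
    funext y
    exact Real.tanh_eq_sinh_div_cosh y
  rw [e]
  exact Real.contDiff_sinh.div Real.contDiff_cosh fun x => (Real.cosh_pos x).ne'

/-- A smooth function has a smooth antiderivative with any prescribed value at a point. -/
theorem exists_contDiff_antiderivative {g : ℝ → ℝ} (hg : ContDiff ℝ (⊤ : ℕ∞) g) (a b : ℝ) :
    ∃ G : ℝ → ℝ, ContDiff ℝ (⊤ : ℕ∞) G ∧ G a = b ∧ ∀ x, HasDerivAt G (g x) x := by
  have h : ∀ x, HasDerivAt (fun u => b + ∫ t in a..u, g t) (g x) x := fun x =>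
    (hg.continuous.integral_hasStrictDerivAt a x).hasDerivAt.const_add b
  refine ⟨fun u => b + ∫ t in a..u, g t, ?_, by simp, h⟩
  refine contDiff_infty_iff_deriv.2 ⟨fun x => (h x).differentiableAt, ?_⟩
  rwa [show deriv (fun u => b + ∫ t in a..u, g t) = g from funext fun x => (h x).deriv]

/-- A smooth function on the line whose derivative is bounded below by a positive constant has a
smooth inverse. -/
theorem exists_contDiff_inverse {T F : ℝ → ℝ} {m : ℝ} (hm : 0 < m)
    (hT : ContDiff ℝ (⊤ : ℕ∞) T) (hd : ∀ t, HasDerivAt T (F t) t) (hF : ∀ t, m ≤ F t) :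
    StrictMono T ∧ ∃ S : ℝ → ℝ, ContDiff ℝ (⊤ : ℕ∞) S ∧ (∀ r, T (S r) = r) ∧
      (∀ t, S (T t) = t) ∧ ∀ r, HasDerivAt S (F (S r))⁻¹ r := by
  have hmono : StrictMono T := strictMono_of_deriv_pos fun t => by
    rw [(hd t).deriv]
    exact hm.trans_le (hF t)
  have hdiff : Differentiable ℝ T := fun t => (hd t).differentiableAt
  have hgrow := mul_sub_le_image_sub_of_le_deriv hdiff (C := m) fun t => by
    rw [(hd t).deriv]
    exact hF t
  have hsurj : Function.Surjective T := by
    refine hdiff.continuous.surjective ?_ ?_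
    · have h1 : Filter.Tendsto (fun t : ℝ => m * t + T 0) Filter.atTop Filter.atTop :=
        Filter.tendsto_atTop_add_const_right _ _ (Filter.tendsto_id.const_mul_atTop hm)
      refine Filter.tendsto_atTop_mono' _ ?_ h1
      filter_upwards [Filter.eventually_ge_atTop 0] with t ht
      linarith [hgrow ht]
    · have h1 : Filter.Tendsto (fun t : ℝ => m * t + T 0) Filter.atBot Filter.atBot :=
        Filter.tendsto_atBot_add_const_right _ _ (Filter.tendsto_id.const_mul_atBot hm)
      refine Filter.tendsto_atBot_mono' _ ?_ h1
      filter_upwards [Filter.eventually_le_atBot 0] with t ht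
      linarith [hgrow ht]
  let e := (hmono.orderIsoOfSurjective T hsurj).toHomeomorph
  have hne : ∀ t, F t ≠ 0 := fun t => (hm.trans_le (hF t)).ne'
  have hTS : ∀ r, T (e.symm r) = r := fun r => e.apply_symm_apply r
  refine ⟨hmono, e.symm, e.contDiff_symm_deriv hne hd hT, hTS, fun t => e.symm_apply_apply t,
    fun r => ?_⟩
  exact (hd (e.symm r)).of_local_left_inverse e.symm.continuous.continuousAt (hne _)
    (Filter.Eventually.of_forall hTS)

theorem exists_abs_deriv_smoothTransition_le :
    ∃ M : ℝ, 0 ≤ M ∧ ∀ x, |deriv Real.smoothTransition x| ≤ M := by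
  have hc : Continuous (deriv Real.smoothTransition) :=
    (Real.smoothTransition.contDiff (n := 1)).continuous_deriv le_rfl
  obtain ⟨M, hM⟩ := (isCompact_Icc (a := (0 : ℝ)) (b := 1)).exists_bound_of_continuousOn
    hc.continuousOn
  have hM0 : 0 ≤ M := (norm_nonneg _).trans (hM 0 (by simp))
  refine ⟨M, hM0, fun x => ?_⟩
  rcases lt_or_ge x 0 with hx | hx
  · have : Real.smoothTransition =ᶠ[nhds x] fun _ => 0 := by
      filter_upwards [Iio_mem_nhds hx] with y hy
      exact Real.smoothTransition.zero_of_nonpos (le_of_lt hy)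
    rw [this.deriv_eq]
    simpa using hM0
  · rcases lt_or_ge 1 x with hx1 | hx1
    · have : Real.smoothTransition =ᶠ[nhds x] fun _ => 1 := by
        filter_upwards [Ioi_mem_nhds hx1] with y hy
        exact Real.smoothTransition.one_of_one_le (le_of_lt hy)
      rw [this.deriv_eq]
      simpa using hM0
    · exact hM x ⟨hx, hx1⟩

/-- A nonnegative smooth function that is the identity on `[t₀, t₁]` and vanishes for large `t`,
but whose derivative stays above `-1/3` to the right of `t₀`. -/
theorem exists_slow_cutoff_of_id {t₀ t₁ : ℝ} (h₀ : 0 < t₀) :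
    ∃ u : ℝ → ℝ, ContDiff ℝ (⊤ : ℕ∞) u ∧ (∀ t, 0 ≤ u t) ∧ (∀ t ∈ Set.Icc t₀ t₁, u t = t) ∧
      (∃ t₂, t₁ ≤ t₂ ∧ ∀ t, t₂ ≤ t → u t = 0) ∧ ∀ t, t₀ ≤ t → -(1 / 3) < deriv u t := by
  obtain ⟨M, hM0, hM⟩ := exists_abs_deriv_smoothTransition_le
  have hp : ContDiff ℝ (⊤ : ℕ∞) Real.smoothTransition := Real.smoothTransition.contDiff
  set δ : ℝ := 1 / (6 * (M + 1)) with hδ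
  have hδ0 : 0 < δ := by positivity
  set w : ℝ → ℝ := fun t => δ * (Real.log (1 + t ^ 2) - Real.log (1 + t₁ ^ 2)) with hw
  have hpos : ∀ t : ℝ, 0 < 1 + t ^ 2 := fun t => by positivity
  have hwc : ContDiff ℝ (⊤ : ℕ∞) w :=
    contDiff_const.mul (((contDiff_const.add (contDiff_id.pow 2)).log
      fun t => (hpos t).ne').sub contDiff_const)
  have hwd : ∀ t, HasDerivAt w (δ * (2 * t / (1 + t ^ 2))) t := fun t => by
    have h : HasDerivAt (fun t : ℝ => 1 + t ^ 2) (2 * t) t := by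
      simpa using (hasDerivAt_pow 2 t).const_add 1
    exact ((h.log (hpos t).ne').sub_const _).const_mul δ
  have hw1 : ∀ t, 0 ≤ t → t ≤ t₁ → w t ≤ 0 := fun t ht0 ht => by
    have : Real.log (1 + t ^ 2) ≤ Real.log (1 + t₁ ^ 2) :=
      Real.log_le_log (hpos t) (by gcongr)
    exact mul_nonpos_of_nonneg_of_nonpos hδ0.le (by linarith)
  have hl1 : ∀ t, t₀ / 2 ≤ t → Real.smoothTransition (2 * t / t₀) = 1 := fun t ht =>
    Real.smoothTransition.one_of_one_le (by rw [le_div_iff₀ h₀]; linarith)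
  refine ⟨fun t => Real.smoothTransition (2 * t / t₀) * (t * (1 - Real.smoothTransition (w t))),
    ?_, fun t => ?_, fun t ht => ?_,
    ⟨max t₁ (Real.exp (1 / δ + Real.log (1 + t₁ ^ 2))), le_max_left _ _, fun t ht => ?_⟩,
    fun t ht => ?_⟩
  · exact (hp.comp ((contDiff_const.mul contDiff_id).div_const _)).mul
      (contDiff_id.mul (contDiff_const.sub (hp.comp hwc)))
  · rcases le_total t 0 with h | h
    · simp [Real.smoothTransition.zero_of_nonpos
        (div_nonpos_of_nonpos_of_nonneg (by linarith : 2 * t ≤ 0) h₀.le)]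
    · exact mul_nonneg (Real.smoothTransition.nonneg _)
        (mul_nonneg h (sub_nonneg.2 (Real.smoothTransition.le_one _)))
  · simp only [hl1 t (by linarith [ht.1]),
      Real.smoothTransition.zero_of_nonpos (hw1 t (by linarith [ht.1]) ht.2)]
    ring
  · have hexp : Real.exp (1 / δ + Real.log (1 + t₁ ^ 2)) ≤ t := (le_max_right _ _).trans ht
    have ht0 : 0 < t := (Real.exp_pos _).trans_le hexp
    have hlog : 1 / δ + Real.log (1 + t₁ ^ 2) ≤ Real.log (1 + t ^ 2) := by
      refine ((Real.le_log_iff_exp_le ht0).2 hexp).trans (Real.log_le_log ht0 ?_)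
      nlinarith [sq_nonneg (t - 1)]
    have : 1 ≤ w t := by
      have h2 : δ * (1 / δ) ≤ w t := mul_le_mul_of_nonneg_left (by linarith) hδ0.le
      rwa [mul_one_div_cancel hδ0.ne'] at h2
    simp [Real.smoothTransition.one_of_one_le this]
  · have hev : (fun t => Real.smoothTransition (2 * t / t₀) *
        (t * (1 - Real.smoothTransition (w t)))) =ᶠ[nhds t]
        fun t => t * (1 - Real.smoothTransition (w t)) := by
      filter_upwards [Ioi_mem_nhds (show t₀ / 2 < t by linarith)] with s hs
      rw [hl1 s (le_of_lt hs), one_mul]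
    have hpd := ((hp.differentiable (by simp)) (w t)).hasDerivAt
    have hd : HasDerivAt (fun t => t * (1 - Real.smoothTransition (w t))) _ t :=
      (hasDerivAt_id t).mul ((hpd.comp t (hwd t)).const_sub 1)
    rw [hev.deriv_eq, hd.deriv]
    have hle : t * (deriv Real.smoothTransition (w t) * (δ * (2 * t / (1 + t ^ 2)))) < 1 / 3 := by
      have e : t * (deriv Real.smoothTransition (w t) * (δ * (2 * t / (1 + t ^ 2)))) =
          deriv Real.smoothTransition (w t) * (2 * δ * (t ^ 2 / (1 + t ^ 2))) := by ring
      have hq0 : 0 ≤ t ^ 2 / (1 + t ^ 2) := by positivity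
      have hq1 : t ^ 2 / (1 + t ^ 2) ≤ 1 := by
        rw [div_le_one (hpos t)]
        linarith
      rw [e]
      calc deriv Real.smoothTransition (w t) * (2 * δ * (t ^ 2 / (1 + t ^ 2)))
          ≤ M * (2 * δ * (t ^ 2 / (1 + t ^ 2))) :=
            mul_le_mul_of_nonneg_right ((le_abs_self _).trans (hM _)) (by positivity)
        _ ≤ M * (2 * δ * 1) := by gcongr
        _ < 1 / 3 := by
            rw [hδ]
            field_simp
            linarith
    have h3 := Real.smoothTransition.le_one (w t)
    simp only [id]
    linarith

/-- The profile of a round sphere of radius `R` in the logarithmic arc-length parameter: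
if `T' = F` and `F' = -F tanh t` on `[t₀, t₁]`, and `F`, `T` agree with the round profile at `t₀`,
they do so on `[t₀, t₁]`. -/
theorem round_profile {F T u : ℝ → ℝ} {R t₀ t₁ : ℝ}
    (hF : ∀ t, HasDerivAt F (-F t * Real.tanh (u t)) t) (hT : ∀ t, HasDerivAt T (F t) t)
    (hu : ∀ t ∈ Set.Icc t₀ t₁, u t = t) (hF₀ : F t₀ = R / Real.cosh t₀)
    (hT₀ : T t₀ = R * Real.arctan (Real.sinh t₀)) :
    ∀ t ∈ Set.Icc t₀ t₁, F t = R / Real.cosh t ∧ T t = R * Real.arctan (Real.sinh t) := by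
  have hFd : ∀ t ∈ Set.Icc t₀ t₁, F t = R / Real.cosh t := by
    have hd : ∀ t, HasDerivAt (fun t => F t * Real.cosh t)
        (-F t * Real.tanh (u t) * Real.cosh t + F t * Real.sinh t) t := fun t =>
      (hF t).mul (Real.hasDerivAt_cosh t)
    have h := constant_of_has_deriv_right_zero (f := fun t => F t * Real.cosh t)
      (a := t₀) (b := t₁) (fun t _ => (hd t).continuousAt.continuousWithinAt) fun t ht => by
        have := (hd t).hasDerivWithinAt (s := Set.Ici t)
        rw [hu t (Set.Ico_subset_Icc_self ht), Real.tanh_eq_sinh_div_cosh] at this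
        refine this.congr_deriv ?_
        have := (Real.cosh_pos t).ne'
        field_simp
        ring
    intro t ht
    have h' := h t ht
    simp only [hF₀, div_mul_cancel₀ _ (Real.cosh_pos t₀).ne'] at h'
    rw [eq_div_iff (Real.cosh_pos t).ne', h']
  refine fun t ht => ⟨hFd t ht, ?_⟩
  have hd : ∀ t, HasDerivAt (fun t => T t - R * Real.arctan (Real.sinh t))
      (F t - R * (1 / (1 + Real.sinh t ^ 2) * Real.cosh t)) t := fun t =>
    (hT t).sub ((Real.hasDerivAt_sinh t).arctan.const_mul R)
  have h := constant_of_has_deriv_right_zero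
    (f := fun t => T t - R * Real.arctan (Real.sinh t))
    (a := t₀) (b := t₁) (fun t _ => (hd t).continuousAt.continuousWithinAt) fun t ht => by
      have := (hd t).hasDerivWithinAt (s := Set.Ici t)
      rw [hFd t (Set.Ico_subset_Icc_self ht), add_comm 1, ← Real.cosh_sq] at this
      refine this.congr_deriv ?_
      have := (Real.cosh_pos t).ne'
      field_simp
      ring
  have h' := h t ht
  simp only [hT₀] at h'
  linarith

theorem cos_arctan_sinh (t : ℝ) : Real.cos (Real.arctan (Real.sinh t)) = 1 / Real.cosh t := by
  rw [Real.cos_arctan, add_comm, ← Real.cosh_sq, Real.sqrt_sq (Real.cosh_pos t).le]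

/-- Both lower Ricci sums are positive as soon as `f f'' < (1 - f'²) / 3`. -/
theorem two_ricci_pos {n f p q : ℝ} (hn : 3 ≤ n) (hf : 0 < f) (hp : p ^ 2 < 1)
    (h : f * q < 1 / 3 * (1 - p ^ 2)) :
    0 < min ((n - 2) * (1 - p ^ 2) / f ^ 2 - n * q / f)
      (2 * (n - 2) * (1 - p ^ 2) / f ^ 2 - 2 * q / f) := by
  have e1 : (n - 2) * (1 - p ^ 2) / f ^ 2 - n * q / f =
      ((n - 2) * (1 - p ^ 2) - n * (f * q)) / f ^ 2 := by
    field_simp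
  have e2 : 2 * (n - 2) * (1 - p ^ 2) / f ^ 2 - 2 * q / f =
      (2 * (n - 2) * (1 - p ^ 2) - 2 * (f * q)) / f ^ 2 := by
    field_simp
  rw [e1, e2]
  refine lt_min (div_pos ?_ (by positivity)) (div_pos ?_ (by positivity))
  · nlinarith [mul_nonneg (sub_nonneg.2 hn) (sub_pos.2 hp).le]
  · nlinarith [mul_nonneg (sub_nonneg.2 hn) (sub_pos.2 hp).le]

/-- The tube with collar angles running from `α` to `β`. -/
theorem exists_tube_profile {R α β : ℝ} (hR : 0 < R) (hα : 0 < α) (hαβ : α ≤ β)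
    (hβ : β < Real.pi / 2) :
    ∃ ρ ∈ Set.Ioo 0 R, ∃ r₂ : ℝ, ∃ f : ℝ → ℝ, ContDiff ℝ (⊤ : ℕ∞) f ∧
      (∀ r, 0 < f r) ∧ (∀ r, deriv f r ^ 2 < 1) ∧
      (∀ r ∈ Set.Icc (R * α) (R * β), f r = R * Real.cos (r / R)) ∧
      (∀ r, r₂ ≤ r → f r = ρ) ∧
      ∀ r, R * α ≤ r → f r * deriv (deriv f) r < 1 / 3 * (1 - deriv f r ^ 2) := by
  have htan : ∀ x y, 0 ≤ x → x ≤ y → y < Real.pi / 2 → Real.tan x ≤ Real.tan y :=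
    fun x y hx hxy hy =>
    Real.strictMonoOn_tan.monotoneOn ⟨by linarith, by linarith⟩ ⟨by linarith, hy⟩ hxy
  set t₀ := Real.arsinh (Real.tan α) with ht₀
  set t₁ := Real.arsinh (Real.tan β) with ht₁
  have h₀ : 0 < t₀ := Real.arsinh_pos_iff.2 (Real.tan_pos_of_pos_of_lt_pi_div_two hα (by linarith))
  have h₁ : t₀ ≤ t₁ := Real.arsinh_le_arsinh.2 (htan α β hα.le hαβ hβ)
  have hgd : ∀ x, 0 ≤ x → x < Real.pi / 2 →
      Real.arctan (Real.sinh (Real.arsinh (Real.tan x))) = x := fun x hx hx' => by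
    rw [Real.sinh_arsinh, Real.arctan_tan (by linarith) hx']
  obtain ⟨u, hu, hu0, huid, ⟨t₂, ht₂, hu2⟩, hud⟩ := exists_slow_cutoff_of_id (t₁ := t₁) h₀
  obtain ⟨G, hG, hG0, hGd⟩ := exists_contDiff_antiderivative (contDiff_real_tanh.comp hu) t₀ 0
  set F : ℝ → ℝ := fun t => R / Real.cosh t₀ * Real.exp (-G t) with hFdef
  have hFc : ContDiff ℝ (⊤ : ℕ∞) F := contDiff_const.mul hG.neg.exp
  have hFd : ∀ t, HasDerivAt F (-F t * Real.tanh (u t)) t := fun t => by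
    refine (((hGd t).fun_neg.exp).const_mul (R / Real.cosh t₀)).congr_deriv ?_
    simp only [hFdef, Function.comp_apply]
    ring
  have hFpos : ∀ t, 0 < F t := fun t =>
    mul_pos (div_pos hR (Real.cosh_pos _)) (Real.exp_pos _)
  have htanh0 : ∀ t, 0 ≤ Real.tanh (u t) := fun t => by
    rw [Real.tanh_eq_sinh_div_cosh]
    exact div_nonneg (Real.sinh_nonneg_iff.2 (hu0 t)) (Real.cosh_pos _).le
  have hFanti : Antitone F := antitone_of_deriv_nonpos
    (fun t => (hFd t).differentiableAt) fun t => by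
      rw [(hFd t).deriv]
      nlinarith [mul_nonneg (hFpos t).le (htanh0 t)]
  have hF2 : ∀ t, t₂ ≤ t → F t = F t₂ := fun t ht =>
    constant_of_has_deriv_right_zero (a := t₂) (b := t)
      (fun s _ => (hFd s).continuousAt.continuousWithinAt) (fun s hs => by
        have := (hFd s).hasDerivWithinAt (s := Set.Ici s)
        simpa [hu2 s hs.1] using this) t ⟨ht, le_rfl⟩
  have hFm : ∀ t, F t₂ ≤ F t := fun t => by
    rcases le_total t t₂ with h | h
    · exact hFanti h
    · exact (hF2 t h).ge
  obtain ⟨T, hT, hT0, hTd⟩ := exists_contDiff_antiderivative hFc t₀ (R * α)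
  obtain ⟨hTmono, S, hS, hTS, hST, hSd⟩ := exists_contDiff_inverse (hFpos t₂) hT hTd hFm
  have hround := round_profile hFd hTd huid (R := R) (by simp [hFdef, hG0])
    (by rw [hT0, ht₀, hgd α hα.le (by linarith)])
  have hSmono : ∀ t r, T t ≤ r → t ≤ S r := fun t r h => by
    rw [← hTmono.le_iff_le, hTS]
    exact h
  have hfd : ∀ r, HasDerivAt (F ∘ S) (-Real.tanh (u (S r))) r := fun r => by
    refine ((hFd (S r)).comp r (hSd r)).congr_deriv ?_
    have := (hFpos (S r)).ne'
    field_simp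
  have hfd' : deriv (F ∘ S) = fun r => -Real.tanh (u (S r)) := funext fun r => (hfd r).deriv
  have hfdd : ∀ r, deriv (deriv (F ∘ S)) r =
      -((1 - Real.tanh (u (S r)) ^ 2) * (deriv u (S r) * (F (S r))⁻¹)) := fun r => by
    rw [hfd']
    have hud' := ((hu.differentiable (by simp)) (S r)).hasDerivAt
    exact (((hasDerivAt_real_tanh (u (S r))).comp r (hud'.comp r (hSd r))).fun_neg).deriv
  have hsq : ∀ x, Real.tanh x ^ 2 < 1 := fun x =>
    (sq_lt_one_iff_abs_lt_one _).2 (Real.abs_tanh_lt_one x)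
  refine ⟨F t₂, ⟨hFpos _, ?_⟩, T t₂, F ∘ S, hFc.comp hS, fun r => hFpos _, fun r => ?_,
    fun r hr => ?_, fun r hr => hF2 _ (hSmono _ _ hr), fun r hr => ?_⟩
  · calc F t₂ ≤ F t₀ := hFanti (h₁.trans ht₂)
      _ = R / Real.cosh t₀ := by simp [hFdef, hG0]
      _ < R := div_lt_self hR (Real.one_lt_cosh.2 h₀.ne')
  · rw [hfd', neg_sq]
    exact hsq _
  · have hr1 : α ≤ r / R := by
      rw [le_div_iff₀ hR]
      linarith [hr.1]
    have hr2 : r / R ≤ β := by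
      rw [div_le_iff₀ hR]
      linarith [hr.2]
    have hgdr := hgd (r / R) (by linarith) (by linarith)
    obtain ⟨hFr, hTr⟩ := hround (Real.arsinh (Real.tan (r / R)))
      ⟨Real.arsinh_le_arsinh.2 (htan _ _ hα.le hr1 (by linarith)),
        Real.arsinh_le_arsinh.2 (htan _ _ (by linarith) hr2 hβ)⟩
    rw [hgdr, mul_div_cancel₀ _ hR.ne'] at hTr
    have hSr := hST (Real.arsinh (Real.tan (r / R)))
    rw [hTr] at hSr
    rw [Function.comp_apply, hSr, hFr, ← mul_one_div, ← cos_arctan_sinh, hgdr]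
  · have hSr : t₀ ≤ S r := hSmono _ _ (hT0.trans_le hr)
    rw [hfdd, hfd', neg_sq, Function.comp_apply]
    have e : F (S r) * -((1 - Real.tanh (u (S r)) ^ 2) * (deriv u (S r) * (F (S r))⁻¹)) =
        -deriv u (S r) * (1 - Real.tanh (u (S r)) ^ 2) := by
      have := (hFpos (S r)).ne'
      field_simp
    rw [e]
    exact mul_lt_mul_of_pos_right (by linarith [hud _ hSr]) (by linarith [hsq (u (S r))])


/-- **Tube Lemma** (warping-function form). For `n ≥ 3`, `R > 0`, `ε ∈ (0,R)`,
with `τ = R·arccos(ε/R)` and `κ = 1/2 + π/(4·arccos(ε/R))`, there exist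
`ρ ∈ (0,R)`, `ℓ` with `ℓ - 1 > κ·τ`, and a smooth positive function `f` on `[τ,ℓ]`
with `|f'| ≤ 1`, equal to `R·cos(r/R)` on `[τ,κτ]`, constant `ρ` on `[ℓ-1,ℓ]`,
and satisfying the 2-positive Ricci curvature condition. -/
theorem tube_lemma (n : ℕ) (hn : 3 ≤ n) (R ε : ℝ) (hR : 0 < R) (hε : ε ∈ Set.Ioo 0 R)
    (τ κ : ℝ) (hτ : τ = R * Real.arccos (ε / R))
    (hκ : κ = 1 / 2 + Real.pi / (4 * Real.arccos (ε / R))) :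
    ∃ ρ ∈ Set.Ioo 0 R, ∃ ℓ : ℝ, κ * τ < ℓ - 1 ∧
      ∃ f : ℝ → ℝ, ContDiff ℝ (⊤ : ℕ∞) f ∧
        (∀ r ∈ Set.Icc τ ℓ, 0 < f r ∧ |deriv f r| ≤ 1) ∧
        (∀ r ∈ Set.Icc τ (κ * τ), f r = R * Real.cos (r / R)) ∧
        (∀ r ∈ Set.Icc (ℓ - 1) ℓ, f r = ρ) ∧
        (∀ r ∈ Set.Icc τ ℓ,
          0 < min
            (((n : ℝ) - 2) * (1 - (deriv f r) ^ 2) / (f r) ^ 2 -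
              (n : ℝ) * deriv (deriv f) r / f r)
            (2 * ((n : ℝ) - 2) * (1 - (deriv f r) ^ 2) / (f r) ^ 2 -
              2 * deriv (deriv f) r / f r)) := by
  have hn' : (3 : ℝ) ≤ n := by exact_mod_cast hn
  set θ := Real.arccos (ε / R) with hθ
  have hθ0 : 0 < θ := Real.arccos_pos.2 ((div_lt_one hR).2 hε.2)
  have hθ1 : θ < Real.pi / 2 := Real.arccos_lt_pi_div_two.2 (div_pos hε.1 hR)
  have hκτ : κ * τ = R * (θ / 2 + Real.pi / 4) := by
    rw [hκ, hτ]
    field_simp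
  obtain ⟨ρ, hρ, r₂, f, hf, hpos, hd, hround, hconst, hric⟩ :=
    exists_tube_profile hR hθ0 (β := θ / 2 + Real.pi / 4) (by linarith) (by linarith)
  have hℓ := le_max_left r₂ (κ * τ)
  have hℓ' := le_max_right r₂ (κ * τ)
  refine ⟨ρ, hρ, max r₂ (κ * τ) + 2, by linarith, f, hf,
    fun r _ => ⟨hpos r, ((sq_lt_one_iff_abs_lt_one _).1 (hd r)).le⟩, fun r hr => ?_,
    fun r hr => hconst r (by linarith [hr.1]), fun r hr => ?_⟩
  · rw [hκτ, hτ] at hr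
    exact hround r hr
  · exact two_ricci_pos hn' (hpos r) (hd r) (hric r (hτ ▸ hr.1))
end

section
/- Let n ≥ 3 be an integer and set n̄ = n/(n−2). Let I be an open interval containing [t₀−1, t₀+1], and let f : I → (0,∞) be continuously differentiable on I, real analytic on I \ {t₀}, with f'' bounded on (t₀−1,t₀) ∪ (t₀,t₀+1), and suppose f''(t) < (1 − f'(t)²)/(n̄·f(t)) for all t ∈ I \ {t₀}. Then there exists α₀ ∈ (0,1] such that for every α ∈ (0,α₀) there is a smooth positive function f̃ : I → ℝ which agrees with f outside (t₀−α, t₀+α) and satisfies f̃''(t) < (1 − f̃'(t)²)/(n̄·f̃(t)) for all t ∈ I. Moreover, if f is smooth on all of I, the functions f̃ can be chosen so that ‖f̃ − f‖_{C²} → 0 as α → 0⁺. -/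
open scoped ContDiff

theorem contDiffOn_infty_of_hasDerivAt {I : Set ℝ} (hI : IsOpen I) {P h : ℝ → ℝ}
    (hP : ∀ t ∈ I, HasDerivAt P (h t) t) (hh : ContDiffOn ℝ ∞ h I) : ContDiffOn ℝ ∞ P I := by
  rw [contDiffOn_infty_iff_deriv_of_isOpen hI]
  exact ⟨fun t ht => (hP t ht).differentiableAt.differentiableWithinAt,
    hh.congr fun t ht => (hP t ht).deriv⟩

theorem exists_hasDerivAt_of_continuousOn {I : Set ℝ} (hI : IsOpen I) (hc : I.OrdConnected)
    {h : ℝ → ℝ} (hh : ContinuousOn h I) {s : ℝ} (hs : s ∈ I) (y : ℝ) :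
    ∃ P : ℝ → ℝ, P s = y ∧ ∀ t ∈ I, HasDerivAt P (h t) t := by
  refine ⟨fun t => y + ∫ x in s..t, h x, by simp, fun t ht => ?_⟩
  exact (intervalIntegral.integral_hasDerivAt_right
    ((hh.mono (hc.uIcc_subset hs ht)).intervalIntegrable)
    (hh.stronglyMeasurableAtFilter hI t ht) (hh.continuousAt (hI.mem_nhds ht))).const_add y

theorem deriv_deriv_eq_of_hasDerivAt {I : Set ℝ} (hI : IsOpen I) {F F₁ F₂ : ℝ → ℝ}
    (h₁ : ∀ t ∈ I, HasDerivAt F (F₁ t) t) {t : ℝ} (ht : t ∈ I) (h₂ : HasDerivAt F₁ (F₂ t) t) :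
    deriv (deriv F) t = F₂ t := by
  have : deriv F =ᶠ[nhds t] F₁ := by
    filter_upwards [hI.mem_nhds ht] with x hx using (h₁ x hx).deriv
  rw [this.deriv_eq, h₂.deriv]

/-- Mean value inequality for a function that may fail to be differentiable at one point. -/
theorem abs_sub_le_of_hasDerivAt_off_point {t₀ a b C : ℝ} {g g' : ℝ → ℝ} (hab : a ≤ b)
    (hg : ContinuousOn g (Set.Icc a b))
    (hg' : ∀ t ∈ Set.Ioo a b, t ≠ t₀ → HasDerivAt g (g' t) t)
    (hC : ∀ t ∈ Set.Ioo a b, t ≠ t₀ → |g' t| ≤ C) : |g b - g a| ≤ C * (b - a) := by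
  have key : ∀ x y, a ≤ x → x ≤ y → y ≤ b → t₀ ∉ Set.Ioo x y → |g y - g x| ≤ C * (y - x) := by
    intro x y hax hxy hyb ht
    rcases hxy.eq_or_lt with rfl | hxy
    · simp
    have hne : ∀ t ∈ Set.Ioo x y, t ≠ t₀ := fun t h e => ht (e ▸ h)
    have hmem : ∀ t ∈ Set.Ioo x y, t ∈ Set.Ioo a b := fun t h =>
      ⟨hax.trans_lt h.1, h.2.trans_le hyb⟩
    obtain ⟨t, h, e⟩ := exists_hasDerivAt_eq_slope g g' hxy
      (hg.mono (Set.Icc_subset_Icc hax hyb)) fun t h => hg' t (hmem t h) (hne t h)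
    have h1 := hC t (hmem t h) (hne t h)
    rw [e, abs_div, abs_of_pos (sub_pos.2 hxy), div_le_iff₀ (sub_pos.2 hxy)] at h1
    exact h1
  by_cases ht : t₀ ∈ Set.Ioo a b
  · have h1 := key a t₀ le_rfl ht.1.le ht.2.le (by simp)
    have h2 := key t₀ b ht.1.le ht.2.le le_rfl (by simp)
    calc |g b - g a| = |(g b - g t₀) + (g t₀ - g a)| := by ring_nf
      _ ≤ |g b - g t₀| + |g t₀ - g a| := abs_add_le _ _
      _ ≤ C * (b - a) := by linarith
  · exact key a b le_rfl hab le_rfl ht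

theorem ricci_expression_perturb_le {k x p q u v w₁ w₂ A τ : ℝ} (hk : 0 ≤ k)
    (hx : |x| ≤ A) (hp : |p| ≤ A) (hq : |q| ≤ A) (hu : |u| ≤ τ) (hv : |v| ≤ τ) (hw₂ : |w₂| ≤ τ)
    (hw₁ : |w₁| ≤ 2 * A) (hτ : τ ≤ 1) :
    k * (x + u) * (q + (w₁ + w₂)) + (p + v) ^ 2 ≤
      k * x * q + p ^ 2 + k * x * w₁ + τ * (4 * k * A + k + 2 * A + 1) := by
  have hA : 0 ≤ A := (abs_nonneg _).trans hp
  have hτ0 : 0 ≤ τ := (abs_nonneg _).trans hu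
  have h2 : x * w₂ ≤ A * τ := by
    refine (le_abs_self _).trans ?_
    rw [abs_mul]; gcongr
  have h3 : u * (q + (w₁ + w₂)) ≤ τ * (3 * A + 1) := by
    refine (le_abs_self _).trans ?_
    rw [abs_mul]
    gcongr
    linarith [abs_add_le q (w₁ + w₂), abs_add_le w₁ w₂]
  have h4 : (2 * p + v) * v ≤ (2 * A + 1) * τ := by
    refine (le_abs_self _).trans ?_
    rw [abs_mul]
    gcongr
    have := abs_add_le (2 * p) v
    rw [abs_mul, abs_two] at this
    linarith
  linarith [mul_le_mul_of_nonneg_left (add_le_add h2 h3) hk]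

/-- A function which is smooth off `t₀` and `C¹` at `t₀`, and whose Ricci expression has uniform
slack near `t₀`, can be smoothed near `t₀` while keeping half of the slack. -/
theorem exists_smoothing_of_slack {I : Set ℝ} (hI : IsOpen I) (hc : I.OrdConnected) {t₀ : ℝ}
    (hII : Set.Icc (t₀ - 1) (t₀ + 1) ⊆ I) {g g₁ g₂ : ℝ → ℝ}
    (hg : ∀ t ∈ I, HasDerivAt g (g₁ t) t) (hg₁c : ContinuousOn g₁ I)
    (hg₁ : ∀ t ∈ I \ {t₀}, HasDerivAt g₁ (g₂ t) t) (hg₂ : ContDiffOn ℝ ∞ g₂ (I \ {t₀}))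
    {A k R c m : ℝ} (hA : 0 < A) (hk : 0 < k) (hR : 0 < R) (hR1 : R < 1) (hc0 : 0 < c) (hm : 0 < m)
    (hbg : ∀ t ∈ Set.Icc (t₀ - R) (t₀ + R), |g t| ≤ A)
    (hbg₁ : ∀ t ∈ Set.Icc (t₀ - R) (t₀ + R), |g₁ t| ≤ A)
    (hbg₂ : ∀ t ∈ Set.Icc (t₀ - R) (t₀ + R), t ≠ t₀ → |g₂ t| ≤ A)
    (hmg : ∀ t ∈ Set.Icc (t₀ - R) (t₀ + R), m ≤ g t)
    (hslack : ∀ t ∈ Set.Icc (t₀ - R) (t₀ + R), t ≠ t₀ → k * g t * g₂ t + g₁ t ^ 2 ≤ 1 - c) :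
    ∃ F F₁ F₂ : ℝ → ℝ, (∀ t ∈ I, HasDerivAt F (F₁ t) t) ∧ (∀ t ∈ I, HasDerivAt F₁ (F₂ t) t) ∧
      ContDiffOn ℝ ∞ F₂ I ∧ (∀ t ∈ I, t ∉ Set.Ioo (t₀ - R) (t₀ + R) → F t = g t) ∧
      (∀ t ∈ Set.Icc (t₀ - R) (t₀ + R), 0 < F t) ∧
      (∀ t ∈ Set.Icc (t₀ - R) (t₀ + R), t ≠ t₀ → k * F t * F₂ t + F₁ t ^ 2 ≤ 1 - c / 2) := by
  have ht₀ : t₀ ∈ I := hII ⟨by linarith, by linarith⟩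
  have hRI : Set.Icc (t₀ - R) (t₀ + R) ⊆ I :=
    (Set.Icc_subset_Icc (by linarith) (by linarith)).trans hII
  set σ : ℝ → ℝ := fun t => Real.smoothTransition ((t - t₀) / R) with hσdef
  have hσ : ContDiff ℝ ∞ σ :=
    Real.smoothTransition.contDiff.comp ((contDiff_id.sub contDiff_const).div_const R)
  have hσ' : ContDiff ℝ ∞ (deriv σ) := (contDiff_infty_iff_deriv.1 hσ).2
  have hσ'' : ContDiff ℝ ∞ (deriv (deriv σ)) := (contDiff_infty_iff_deriv.1 hσ').2
  have hσd : ∀ t, HasDerivAt σ (deriv σ t) t := fun t =>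
    ((contDiff_infty_iff_deriv.1 hσ).1 t).hasDerivAt
  have hσd' : ∀ t, HasDerivAt (deriv σ) (deriv (deriv σ) t) t := fun t =>
    ((contDiff_infty_iff_deriv.1 hσ').1 t).hasDerivAt
  have hσ0 : ∀ t, t ≤ t₀ → σ t = 0 := fun t ht =>
    Real.smoothTransition.zero_of_nonpos (div_nonpos_of_nonpos_of_nonneg (by linarith) hR.le)
  have hσ1 : ∀ t, t₀ + R ≤ t → σ t = 1 := fun t ht =>
    Real.smoothTransition.one_of_one_le ((one_le_div hR).2 (by linarith))
  obtain ⟨S, hS1, hS⟩ : ∃ S : ℝ, 1 ≤ S ∧ ∀ t ∈ Set.Icc (t₀ - R) (t₀ + R),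
      |σ t| ≤ S ∧ |deriv σ t| ≤ S ∧ |deriv (deriv σ) t| ≤ S := by
    have hK : IsCompact (Set.Icc (t₀ - R) (t₀ + R)) := isCompact_Icc
    obtain ⟨S₀, h₀⟩ := hK.exists_bound_of_continuousOn hσ.continuous.continuousOn
    obtain ⟨S₁, h₁⟩ := hK.exists_bound_of_continuousOn hσ'.continuous.continuousOn
    obtain ⟨S₂, h₂⟩ := hK.exists_bound_of_continuousOn hσ''.continuous.continuousOn
    refine ⟨max 1 (max S₀ (max S₁ S₂)), le_max_left _ _, fun t ht => ⟨?_, ?_, ?_⟩⟩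
    · exact (h₀ t ht).trans (by simp)
    · exact (h₁ t ht).trans (by simp)
    · exact (h₂ t ht).trans (by simp)
  set L : ℝ := 4 * k * A + k + 2 * A + 1 with hL
  have hLpos : 0 < L := by positivity
  obtain ⟨τ, hτ0, hτ1, hτm, hτc⟩ : ∃ τ : ℝ, 0 < τ ∧ τ ≤ 1 ∧ τ ≤ m / 2 ∧ τ * L ≤ c / 2 := by
    refine ⟨min 1 (min (m / 2) (c / 2 / L)), by positivity, min_le_left _ _,
      (min_le_right _ _).trans (min_le_left _ _), ?_⟩
    rw [← le_div_iff₀ hLpos]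
    exact (min_le_right _ _).trans (min_le_right _ _)
  have hSpos : 0 < S := by linarith
  obtain ⟨δ, hδ0, hδR, hδτ⟩ : ∃ δ : ℝ, 0 < δ ∧ δ ≤ R ∧ δ * (24 * A * S) ≤ τ := by
    refine ⟨min R (τ / (24 * A * S)), by positivity, min_le_left _ _, ?_⟩
    rw [← le_div_iff₀ (by positivity)]
    exact min_le_right _ _
  set χ : ContDiffBump t₀ := ⟨δ / 2, δ, by positivity, by linarith⟩ with hχ
  have hχs : ContDiff ℝ ∞ χ := χ.contDiff
  have hχ0 : ∀ t, δ ≤ |t - t₀| → χ t = 0 := fun t ht => χ.zero_of_le_dist ht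
  set h : ℝ → ℝ := fun t => g₂ t * (1 - χ t) - A * χ t with hh
  have hhs : ContDiffOn ℝ ∞ h I := by
    intro t ht
    refine ContDiffAt.contDiffWithinAt ?_
    by_cases e : t = t₀
    · have : h =ᶠ[nhds t] fun _ => -A := by
        have hb : Metric.ball t₀ (δ / 2) ∈ nhds t := by
          rw [e]; exact Metric.ball_mem_nhds _ (by positivity)
        filter_upwards [hb] with x hx
        have : χ x = 1 := χ.one_of_mem_closedBall (Metric.ball_subset_closedBall hx)
        simp [hh, this]
      exact contDiffAt_const.congr_of_eventuallyEq this
    · have h1 : ContDiffAt ℝ ∞ g₂ t :=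
        hg₂.contDiffAt ((hI.sdiff isClosed_singleton).mem_nhds ⟨ht, e⟩)
      exact (h1.mul (contDiffAt_const.sub hχs.contDiffAt)).sub
        (contDiffAt_const.mul hχs.contDiffAt)
  have hs : t₀ - δ ∈ I := hRI ⟨by linarith, by linarith⟩
  have he : t₀ + δ ∈ I := hRI ⟨by linarith, by linarith⟩
  obtain ⟨P₁, hP₁s, hP₁⟩ :=
    exists_hasDerivAt_of_continuousOn hI hc hhs.continuousOn hs (g₁ (t₀ - δ))
  have hP₁c : ContinuousOn P₁ I := fun t ht => (hP₁ t ht).continuousAt.continuousWithinAt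
  obtain ⟨P, hPs, hP⟩ := exists_hasDerivAt_of_continuousOn hI hc hP₁c hs (g (t₀ - δ))
  set d : ℝ → ℝ := fun t => P₁ t - g₁ t with hd
  set e : ℝ → ℝ := fun t => P t - g t with he_def
  have hds : d (t₀ - δ) = 0 := by simp [hd, hP₁s]
  have hes : e (t₀ - δ) = 0 := by simp [he_def, hPs]
  have hdc : ContinuousOn d I := hP₁c.sub hg₁c
  have hdd : ∀ t ∈ I, t ≠ t₀ → HasDerivAt d (-(χ t * (g₂ t + A))) t := fun t ht hne =>
    ((hP₁ t ht).sub (hg₁ t ⟨ht, hne⟩)).congr_deriv (by simp only [hh]; ring)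
  have hed : ∀ t ∈ I, HasDerivAt e (d t) t := fun t ht => (hP t ht).sub (hg t ht)
  have hec : ContinuousOn e I := fun t ht => (hed t ht).continuousAt.continuousWithinAt
  have hd_left : ∀ t ∈ I, t ≤ t₀ - δ → d t = 0 := by
    intro t ht hle
    have := abs_sub_le_of_hasDerivAt_off_point (t₀ := t₀) (C := 0) hle
      (hdc.mono (hc.out ht hs))
      (fun x hx hne => hdd x (hc.out ht hs (Set.Ioo_subset_Icc_self hx)) hne)
      (fun x hx _ => by
        rw [hχ0 x (by rw [abs_of_nonpos] <;> linarith [hx.2])]; simp)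
    rw [zero_mul, hds, zero_sub, abs_neg] at this
    exact abs_nonpos_iff.1 this
  have hd_right : ∀ t ∈ I, t₀ + δ ≤ t → d t = d (t₀ + δ) := by
    intro t ht hle
    have := abs_sub_le_of_hasDerivAt_off_point (t₀ := t₀) (C := 0) hle
      (hdc.mono (hc.out he ht))
      (fun x hx hne => hdd x (hc.out he ht (Set.Ioo_subset_Icc_self hx)) hne)
      (fun x hx _ => by
        rw [hχ0 x (by rw [abs_of_nonneg] <;> linarith [hx.1])]; simp)
    rw [zero_mul] at this
    exact sub_eq_zero.1 (abs_nonpos_iff.1 this)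
  have hχw : ∀ t ∈ Set.Icc (t₀ - R) (t₀ + R), t ≠ t₀ →
      |-(χ t * (g₂ t + A))| ≤ 2 * A ∧ -(χ t * (g₂ t + A)) ≤ 0 := by
    intro t ht hne
    have h1 := abs_le.1 (hbg₂ t ht hne)
    have h2 : 0 ≤ χ t := χ.nonneg
    have h3 : χ t ≤ 1 := χ.le_one
    have h4 : 0 ≤ χ t * (g₂ t + A) := mul_nonneg h2 (by linarith)
    refine ⟨?_, by linarith⟩
    rw [abs_neg, abs_of_nonneg h4]
    nlinarith
  have hd_mid : ∀ t ∈ Set.Icc (t₀ - δ) (t₀ + δ), |d t| ≤ 4 * A * δ := by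
    intro t ht
    have htI : t ∈ I := hc.out hs he ht
    have := abs_sub_le_of_hasDerivAt_off_point (t₀ := t₀) (C := 2 * A) ht.1
      (hdc.mono (hc.out hs htI))
      (fun x hx hne => hdd x (hc.out hs htI (Set.Ioo_subset_Icc_self hx)) hne)
      (fun x hx hne => (hχw x ⟨by linarith [hx.1], by linarith [hx.2, ht.2]⟩ hne).1)
    rw [hds, sub_zero] at this
    nlinarith [ht.2]
  have hd_all : ∀ t ∈ I, |d t| ≤ 4 * A * δ := by
    intro t ht
    rcases le_total t (t₀ - δ) with h1 | h1
    · rw [hd_left t ht h1, abs_zero]; positivity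
    rcases le_total t (t₀ + δ) with h2 | h2
    · exact hd_mid t ⟨h1, h2⟩
    · rw [hd_right t ht h2]; exact hd_mid _ ⟨by linarith, le_rfl⟩
  have he_left : ∀ t ∈ I, t ≤ t₀ - δ → e t = 0 := by
    intro t ht hle
    have := abs_sub_le_of_hasDerivAt_off_point (t₀ := t₀) (C := 0) hle
      (hec.mono (hc.out ht hs))
      (fun x hx _ => hed x (hc.out ht hs (Set.Ioo_subset_Icc_self hx)))
      (fun x hx _ => by
        rw [hd_left x (hc.out ht hs (Set.Ioo_subset_Icc_self hx)) hx.2.le]; simp)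
    rw [zero_mul, hes, zero_sub, abs_neg] at this
    exact abs_nonpos_iff.1 this
  have he_mid : ∀ t ∈ Set.Icc (t₀ - R) (t₀ + R), |e t| ≤ 8 * A * δ := by
    intro t ht
    have htI : t ∈ I := hRI ht
    rcases le_total t (t₀ - δ) with h1 | h1
    · rw [he_left t htI h1, abs_zero]; positivity
    have := abs_sub_le_of_hasDerivAt_off_point (t₀ := t₀) (C := 4 * A * δ) h1
      (hec.mono (hc.out hs htI))
      (fun x hx _ => hed x (hc.out hs htI (Set.Ioo_subset_Icc_self hx)))
      (fun x hx _ => hd_all x (hc.out hs htI (Set.Ioo_subset_Icc_self hx)))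
    rw [hes, sub_zero] at this
    have h3 : 4 * A * δ * (t - (t₀ - δ)) ≤ 4 * A * δ * 2 := by
      gcongr; linarith [ht.2]
    linarith
  set b : ℝ := d (t₀ + δ) with hb
  set ℓ : ℝ → ℝ := fun t => e (t₀ + δ) + b * (t - (t₀ + δ)) with hℓ
  have hℓd : ∀ t, HasDerivAt ℓ b t := fun t => 
    ((((hasDerivAt_id t).sub_const (t₀ + δ)).const_mul b).const_add (e (t₀ + δ))).congr_deriv
      (mul_one b)
  have hℓs : ContDiff ℝ ∞ ℓ :=
    contDiff_const.add (contDiff_const.mul (contDiff_id.sub contDiff_const))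
  have he_right : ∀ t ∈ I, t₀ + δ ≤ t → e t = ℓ t := by
    intro t ht hle
    have := abs_sub_le_of_hasDerivAt_off_point (t₀ := t₀) (C := 0) (g := fun x => e x - ℓ x)
      (g' := fun x => d x - b) hle
      ((hec.mono (hc.out he ht)).sub hℓs.continuous.continuousOn)
      (fun x hx _ => (hed x (hc.out he ht (Set.Ioo_subset_Icc_self hx))).sub (hℓd x))
      (fun x hx _ => by
        rw [hd_right x (hc.out he ht (Set.Ioo_subset_Icc_self hx)) hx.1.le]; simp [hb])
    rw [zero_mul] at this
    have h2 := abs_nonpos_iff.1 this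
    simp only [hℓ] at h2 ⊢
    linarith
  have hb_le : |b| ≤ 4 * A * δ := hd_all _ he
  have hℓ_le : ∀ t ∈ Set.Icc (t₀ - R) (t₀ + R), |ℓ t| ≤ 16 * A * δ := by
    intro t ht
    have h1 : |e (t₀ + δ)| ≤ 8 * A * δ := he_mid _ ⟨by linarith, by linarith⟩
    have h2 : |t - (t₀ + δ)| ≤ 2 := abs_le.2 ⟨by linarith [ht.1], by linarith [ht.2]⟩
    have h3 : |b * (t - (t₀ + δ))| ≤ 4 * A * δ * 2 := by rw [abs_mul]; gcongr
    linarith [abs_add_le (e (t₀ + δ)) (b * (t - (t₀ + δ)))]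
  refine ⟨fun t => P t - ℓ t * σ t, fun t => P₁ t - (b * σ t + ℓ t * deriv σ t),
    fun t => h t - (b * deriv σ t + (b * deriv σ t + ℓ t * deriv (deriv σ) t)),
    fun t ht => (hP t ht).sub ((hℓd t).mul (hσd t)),
    fun t ht => (hP₁ t ht).sub (((hσd t).const_mul b).add ((hℓd t).mul (hσd' t))),
    hhs.sub (ContDiff.contDiffOn ?_), ?_, ?_⟩
  · exact (contDiff_const.mul hσ').add ((contDiff_const.mul hσ').add (hℓs.mul hσ''))
  · intro t ht hn
    rcases le_or_gt t (t₀ - R) with h1 | h1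
    · have := he_left t ht (by linarith)
      simp only [he_def] at this
      simp only [hσ0 t (by linarith), mul_zero, sub_zero]
      linarith
    · have h2 : t₀ + R ≤ t := not_lt.1 fun h => hn ⟨h1, h⟩
      have := he_right t ht (by linarith)
      simp only [he_def] at this
      simp only [hσ1 t h2, mul_one]
      linarith
  have bound : ∀ t ∈ Set.Icc (t₀ - R) (t₀ + R),
      |e t - ℓ t * σ t| ≤ τ ∧ |d t - (b * σ t + ℓ t * deriv σ t)| ≤ τ ∧
      |-(b * deriv σ t + (b * deriv σ t + ℓ t * deriv (deriv σ) t))| ≤ τ := by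
    intro t ht
    obtain ⟨s0, s1, s2⟩ := hS t ht
    have e0 := he_mid t ht
    have d0 := hd_all t (hRI ht)
    have l0 := hℓ_le t ht
    have p1 : |ℓ t * σ t| ≤ 16 * A * δ * S := by rw [abs_mul]; gcongr
    have p2 : |b * σ t| ≤ 4 * A * δ * S := by rw [abs_mul]; gcongr
    have p3 : |ℓ t * deriv σ t| ≤ 16 * A * δ * S := by rw [abs_mul]; gcongr
    have p4 : |b * deriv σ t| ≤ 4 * A * δ * S := by rw [abs_mul]; gcongr
    have p5 : |ℓ t * deriv (deriv σ) t| ≤ 16 * A * δ * S := by rw [abs_mul]; gcongr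
    have q : A * δ ≤ A * δ * S := le_mul_of_one_le_right (by positivity) hS1
    have hτ' : 24 * (A * δ * S) ≤ τ := by linarith
    simp only [abs_le] at e0 d0 p1 p2 p3 p4 p5 ⊢
    refine ⟨⟨?_, ?_⟩, ⟨?_, ?_⟩, ?_, ?_⟩ <;> linarith
  refine ⟨fun t ht => ?_, fun t ht hne => ?_⟩
  · have h1 := (abs_le.1 (bound t ht).1).1
    have h2 := hmg t ht
    simp only [he_def] at h1
    linarith
  · obtain ⟨b0, b1, b2⟩ := bound t ht
    have := ricci_expression_perturb_le hk.le (hbg t ht) (hbg₁ t ht)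
      (hbg₂ t ht hne) b0 b1 b2 (hχw t ht hne).1 hτ1
    have hneg := mul_nonpos_of_nonneg_of_nonpos (mul_nonneg hk.le (hm.le.trans (hmg t ht)))
      (hχw t ht hne).2
    have hsl := hslack t ht hne
    refine le_trans (le_of_eq ?_) (this.trans (by linarith))
    simp only [he_def, hd, hh]
    ring

/-- A smooth bump supported in `[t₀ - 2r, t₀ + 2r]` equal to `-(t - t₀)² / 2` on
`(t₀ - r, t₀ + r)`. -/
theorem exists_concave_bump (t₀ : ℝ) {r : ℝ} (hr : 0 < r) :
    ∃ ψ : ℝ → ℝ, ContDiff ℝ ∞ ψ ∧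
      (∀ t, 2 * r ≤ |t - t₀| → ψ t = 0) ∧
      (∃ B : ℝ, 1 ≤ B ∧ ∀ t, |ψ t| ≤ B ∧ |deriv ψ t| ≤ B ∧ |deriv (deriv ψ) t| ≤ B) ∧
      ∀ t ∈ Set.Ioo (t₀ - r) (t₀ + r),
        ψ t = -((t - t₀) ^ 2 / 2) ∧ deriv ψ t = -(t - t₀) ∧ deriv (deriv ψ) t = -1 := by
  set χ : ContDiffBump t₀ := ⟨r, 2 * r, hr, by linarith⟩
  set ψ : ℝ → ℝ := fun t => -((t - t₀) ^ 2 / 2) * χ t with hψ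
  have hs : ContDiff ℝ ∞ ψ :=
    (((contDiff_id.sub contDiff_const).pow 2).div_const 2).neg.mul χ.contDiff
  have hs' : ContDiff ℝ ∞ (deriv ψ) := (contDiff_infty_iff_deriv.1 hs).2
  have hs'' : ContDiff ℝ ∞ (deriv (deriv ψ)) := (contDiff_infty_iff_deriv.1 hs').2
  have h0 : ∀ t, 2 * r ≤ |t - t₀| → ψ t = 0 := fun t ht => by
    have : χ t = 0 := χ.zero_of_le_dist ht
    simp [hψ, this]
  have hK : HasCompactSupport ψ := by
    refine HasCompactSupport.intro (isCompact_closedBall t₀ (2 * r)) fun t ht => h0 t ?_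
    rw [Metric.mem_closedBall, Real.dist_eq, not_le] at ht
    exact ht.le
  refine ⟨ψ, hs, h0, ?_, ?_⟩
  · obtain ⟨B₀, h₀⟩ := hK.exists_bound_of_continuous hs.continuous
    obtain ⟨B₁, h₁⟩ := hK.deriv.exists_bound_of_continuous hs'.continuous
    obtain ⟨B₂, h₂⟩ := hK.deriv.deriv.exists_bound_of_continuous hs''.continuous
    refine ⟨max 1 (max B₀ (max B₁ B₂)), le_max_left _ _, fun t => ⟨?_, ?_, ?_⟩⟩
    · exact (h₀ t).trans (by simp)
    · exact (h₁ t).trans (by simp)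
    · exact (h₂ t).trans (by simp)
  · intro t ht
    have hval : ∀ x ∈ Set.Ioo (t₀ - r) (t₀ + r), ψ x = -((x - t₀) ^ 2 / 2) := fun x hx => by
      have : χ x = 1 := χ.one_of_mem_closedBall (by
        rw [Metric.mem_closedBall, Real.dist_eq, abs_le]
        constructor <;> linarith [hx.1, hx.2])
      simp [hψ, this]
    have hd : ∀ x ∈ Set.Ioo (t₀ - r) (t₀ + r), HasDerivAt ψ (-(x - t₀)) x := fun x hx => by
      have h1 : HasDerivAt (fun y : ℝ => -((y - t₀) ^ 2 / 2)) (-(x - t₀)) x :=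
        (((((hasDerivAt_id x).sub_const t₀).pow 2).div_const 2).neg).congr_deriv (by simp)
      refine h1.congr_of_eventuallyEq ?_
      filter_upwards [isOpen_Ioo.mem_nhds hx] with y hy using hval y hy
    have hd' : HasDerivAt (fun x : ℝ => -(x - t₀)) (-1) t :=
      ((hasDerivAt_id t).sub_const t₀).neg
    exact ⟨hval t ht, (hd t ht).deriv,
      deriv_deriv_eq_of_hasDerivAt (F₂ := fun _ => -1) isOpen_Ioo hd ht hd'⟩

/-- The strict Ricci inequality off `t₀` can be given uniform slack near `t₀` by adding an
arbitrarily `C²`-small smooth function supported near `t₀`. -/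
theorem exists_slack_perturbation {t₀ : ℝ} {f f₁ f₂ : ℝ → ℝ} {A k r m η : ℝ} (hk : 0 < k)
    (hr : 0 < r) (hm : 0 < m) (hη : 0 < η) (hA : 1 ≤ A)
    (hfc : ContinuousOn f (Set.Icc (t₀ - 2 * r) (t₀ + 2 * r)))
    (hf₁c : ContinuousOn f₁ (Set.Icc (t₀ - 2 * r) (t₀ + 2 * r)))
    (hf₂c : ContinuousOn f₂ (Set.Icc (t₀ - 2 * r) (t₀ + 2 * r) \ {t₀}))
    (hbf : ∀ t ∈ Set.Icc (t₀ - 2 * r) (t₀ + 2 * r), |f t| ≤ A)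
    (hbf₁ : ∀ t ∈ Set.Icc (t₀ - 2 * r) (t₀ + 2 * r), |f₁ t| ≤ A)
    (hbf₂ : ∀ t ∈ Set.Icc (t₀ - 2 * r) (t₀ + 2 * r), t ≠ t₀ → |f₂ t| ≤ A)
    (hmf : ∀ t ∈ Set.Icc (t₀ - 2 * r) (t₀ + 2 * r), m ≤ f t)
    (hr1 : r ≤ 1) (hrm : r * (4 * k * A + k + 2 * A + 1) ≤ k * m / 2)
    (hlt : ∀ t ∈ Set.Icc (t₀ - 2 * r) (t₀ + 2 * r), t ≠ t₀ → k * f t * f₂ t + f₁ t ^ 2 < 1) :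
    ∃ φ : ℝ → ℝ, ContDiff ℝ ∞ φ ∧ (∀ t, 2 * r ≤ |t - t₀| → φ t = 0) ∧
      (∀ t, |φ t| ≤ η ∧ |deriv φ t| ≤ η ∧ |deriv (deriv φ) t| ≤ η) ∧
      ∃ c > 0, ∀ t ∈ Set.Icc (t₀ - 2 * r) (t₀ + 2 * r), t ≠ t₀ →
        k * (f t + φ t) * (f₂ t + deriv (deriv φ) t) + (f₁ t + deriv φ t) ^ 2 ≤ 1 - c := by
  obtain ⟨ψ, hψ, hψ0, ⟨B, hB1, hB⟩, hψc⟩ := exists_concave_bump t₀ hr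
  have hψ' : ContDiff ℝ ∞ (deriv ψ) := (contDiff_infty_iff_deriv.1 hψ).2
  set K : Set ℝ := Set.Icc (t₀ - 2 * r) (t₀ + 2 * r) \ Set.Ioo (t₀ - r) (t₀ + r) with hK
  have hKc : IsCompact K := isCompact_Icc.diff isOpen_Ioo
  have hKne : ∀ t ∈ K, t ≠ t₀ := by
    rintro t ht rfl
    exact ht.2 ⟨by linarith, by linarith⟩
  obtain ⟨s, hs0, hs⟩ : ∃ s : ℝ, 0 < s ∧ ∀ t ∈ K, k * f t * f₂ t + f₁ t ^ 2 ≤ 1 - s := by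
    have hcont : ContinuousOn (fun t => k * f t * f₂ t + f₁ t ^ 2) K := by
      have h1 := hfc.mono (Set.sdiff_subset : K ⊆ _)
      have h2 := hf₁c.mono (Set.sdiff_subset : K ⊆ _)
      have h3 := hf₂c.mono (show K ⊆ _ from fun t ht => ⟨ht.1, hKne t ht⟩)
      exact ((continuousOn_const.mul h1).mul h3).add (h2.pow 2)
    have hne : K.Nonempty :=
      ⟨t₀ + 2 * r, ⟨by linarith, le_rfl⟩, fun h => by linarith [h.2]⟩
    obtain ⟨x, hx, hmax⟩ := hKc.exists_isMaxOn hne hcont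
    refine ⟨1 - (k * f x * f₂ x + f₁ x ^ 2), by linarith [hlt x hx.1 (hKne x hx)], fun t ht => ?_⟩
    have : k * f t * f₂ t + f₁ t ^ 2 ≤ k * f x * f₂ x + f₁ x ^ 2 := hmax ht
    linarith
  set L : ℝ := 4 * k * A + k + 2 * A + 1 with hL
  have hLpos : 0 < L := by positivity
  have hBpos : 0 < B := by linarith
  obtain ⟨ε, hε0, hε1, hεη, hεs⟩ : ∃ ε : ℝ, 0 < ε ∧ ε * B ≤ 1 ∧ ε * B ≤ η ∧ ε * B * L ≤ s / 2 := by
    refine ⟨min 1 (min η (s / 2 / L)) / B, by positivity, ?_, ?_, ?_⟩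
    · rw [div_mul_cancel₀ _ hBpos.ne']; exact min_le_left _ _
    · rw [div_mul_cancel₀ _ hBpos.ne']; exact (min_le_right _ _).trans (min_le_left _ _)
    · rw [div_mul_cancel₀ _ hBpos.ne', ← le_div_iff₀ hLpos]
      exact (min_le_right _ _).trans (min_le_right _ _)
  have hd1 : deriv (fun t => ε * ψ t) = fun t => ε * deriv ψ t := by
    funext t
    exact ((((contDiff_infty_iff_deriv.1 hψ).1 t).hasDerivAt).const_mul ε).deriv
  have hd2 : deriv (deriv fun t => ε * ψ t) = fun t => ε * deriv (deriv ψ) t := by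
    rw [hd1]
    funext t
    exact ((((contDiff_infty_iff_deriv.1 hψ').1 t).hasDerivAt).const_mul ε).deriv
  have hscale : ∀ {x : ℝ}, |x| ≤ B → |ε * x| ≤ ε * B := fun {x} hx => by
    rw [abs_mul, abs_of_pos hε0]; gcongr
  refine ⟨fun t => ε * ψ t, contDiff_const.mul hψ, fun t ht => by simp [hψ0 t ht], ?_, ?_⟩
  · intro t
    rw [hd2, hd1]
    obtain ⟨b0, b1, b2⟩ := hB t
    exact ⟨(hscale b0).trans hεη, (hscale b1).trans hεη, (hscale b2).trans hεη⟩
  refine ⟨min (s / 2) (ε * (k * m / 2)), by positivity, fun t ht hne => ?_⟩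
  rw [hd2, hd1]
  by_cases hin : t ∈ Set.Ioo (t₀ - r) (t₀ + r)
  · refine le_trans ?_ (sub_le_sub_left (min_le_right _ _) 1)
    obtain ⟨e0, e1, e2⟩ := hψc t hin
    have hεone : ε ≤ 1 := by nlinarith
    have hx : |t - t₀| ≤ r := abs_le.2 ⟨by linarith [hin.1], by linarith [hin.2]⟩
    have hsq : (t - t₀) ^ 2 ≤ r ^ 2 := sq_le_sq' (by linarith [hin.1]) (by linarith [hin.2])
    have hu : |ε * ψ t| ≤ ε * r := by
      rw [abs_mul, abs_of_pos hε0, e0, abs_neg, abs_of_nonneg (by positivity)]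
      gcongr
      nlinarith
    have hv : |ε * deriv ψ t| ≤ ε * r := by
      rw [abs_mul, abs_of_pos hε0, e1, abs_neg]
      gcongr
    have h1 := ricci_expression_perturb_le (w₁ := -ε) (w₂ := 0) hk.le
      (hbf t ht) (hbf₁ t ht) (hbf₂ t ht hne) hu hv (by simpa using by positivity)
      (by rw [abs_neg, abs_of_pos hε0]; linarith) (by nlinarith)
    rw [add_zero] at h1
    simp only [e2, mul_neg_one]
    have h2 : k * m * ε ≤ k * f t * ε := by gcongr; exact hmf t ht
    have h3 : ε * (r * L) ≤ ε * (k * m / 2) := by gcongr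
    linarith [hlt t ht hne]
  · refine le_trans ?_ (sub_le_sub_left (min_le_left _ _) 1)
    obtain ⟨b0, b1, b2⟩ := hB t
    have := ricci_expression_perturb_le (w₁ := 0) hk.le
      (hbf t ht) (hbf₁ t ht) (hbf₂ t ht hne) (hscale b0) (hscale b1) (hscale b2)
      (by simpa using by linarith) hε1
    rw [zero_add, mul_zero, add_zero] at this
    linarith [hs t ⟨ht, hin⟩]

/-- A smooth function which agrees with `f` away from `t₀` and has uniform slack in the Ricci
expression on a punctured neighbourhood of `t₀` satisfies the Ricci inequality everywhere. -/
theorem ricci_inequality_of_slack {I : Set ℝ} (hI : IsOpen I) {t₀ k R c α : ℝ} (hk : 0 < k)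
    (hR : 0 < R) (hRα : R ≤ α) (hc : 0 < c) (hRI : Set.Icc (t₀ - R) (t₀ + R) ⊆ I)
    {f F F₁ F₂ : ℝ → ℝ}
    (hF : ∀ t ∈ I, HasDerivAt F (F₁ t) t) (hF₁ : ∀ t ∈ I, HasDerivAt F₁ (F₂ t) t)
    (hF₂ : ContDiffOn ℝ ∞ F₂ I)
    (heq : ∀ t ∈ I, t ∉ Set.Ioo (t₀ - R) (t₀ + R) → F t = f t)
    (hFpos : ∀ t ∈ Set.Icc (t₀ - R) (t₀ + R), 0 < F t)
    (hslack : ∀ t ∈ Set.Icc (t₀ - R) (t₀ + R), t ≠ t₀ → k * F t * F₂ t + F₁ t ^ 2 ≤ 1 - c)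
    (hpos : ∀ t ∈ I, 0 < f t)
    (hric : ∀ t ∈ I \ {t₀}, deriv (deriv f) t < (1 - (deriv f t) ^ 2) / (k * f t)) :
    ContDiffOn ℝ ∞ F I ∧ (∀ t ∈ I, 0 < F t) ∧
      (∀ t ∈ I \ Set.Ioo (t₀ - α) (t₀ + α), F t = f t) ∧
      (∀ t ∈ I, deriv (deriv F) t < (1 - (deriv F t) ^ 2) / (k * F t)) := by
  have hFpos' : ∀ t ∈ I, 0 < F t := by
    intro t ht
    by_cases h : t ∈ Set.Ioo (t₀ - R) (t₀ + R)
    · exact hFpos t (Set.Ioo_subset_Icc_self h)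
    · rw [heq t ht h]; exact hpos t ht
  refine ⟨contDiffOn_infty_of_hasDerivAt hI hF (contDiffOn_infty_of_hasDerivAt hI hF₁ hF₂),
    hFpos', ?_, ?_⟩
  · exact fun t ht => heq t ht.1 fun h => ht.2 ⟨by linarith [h.1], by linarith [h.2]⟩
  intro t ht
  by_cases hin : t ∈ Set.Icc (t₀ - R) (t₀ + R)
  · have hle : k * F t * F₂ t + F₁ t ^ 2 ≤ 1 - c := by
      by_cases hne : t = t₀
      · have hcont : ContinuousAt (fun x => k * F x * F₂ x + F₁ x ^ 2) t :=
          ((continuousAt_const.mul (hF t ht).continuousAt).mul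
            (hF₂.continuousOn.continuousAt (hI.mem_nhds ht))).add
            ((hF₁ t ht).continuousAt.pow 2)
        refine le_of_tendsto (hcont.tendsto.mono_left (nhdsWithin_le_nhds (s := {t}ᶜ))) ?_
        have hnb : Set.Icc (t₀ - R) (t₀ + R) ∈ nhds t := by
          rw [hne]; exact Icc_mem_nhds (by linarith) (by linarith)
        filter_upwards [mem_nhdsWithin_of_mem_nhds hnb, self_mem_nhdsWithin] with x hx hxt
        exact hslack x hx (hne ▸ hxt)
      · exact hslack t hin hne
    rw [deriv_deriv_eq_of_hasDerivAt hI hF ht (hF₁ t ht), (hF t ht).deriv,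
      lt_div_iff₀ (mul_pos hk (hFpos' t ht))]
    linarith
  · have hev : F =ᶠ[nhds t] f := by
      filter_upwards [hI.mem_nhds ht, isClosed_Icc.isOpen_compl.mem_nhds hin] with x hx hx'
      exact heq x hx fun h => hx' (Set.Ioo_subset_Icc_self h)
    have hne : t ≠ t₀ := by
      rintro rfl
      exact hin ⟨by linarith, by linarith⟩
    rw [hev.deriv.deriv_eq, hev.deriv_eq, hev.eq_of_nhds]
    exact hric t ⟨ht, hne⟩

/-- **Main smoothing corollary.** A positive `C¹` warping function on an open
interval `I ⊇ [t₀-1, t₀+1]`, real analytic away from `t₀`, with bounded second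
derivative near `t₀`, satisfying the strict Ric₂ inequality
`f'' < (1 - f'²)/(n̄·f)` away from `t₀`, can be smoothed near `t₀`: there is
`α₀ ∈ (0,1]` and a family of smooth positive functions `F α`, agreeing with `f`
outside `(t₀-α, t₀+α)`, satisfying the Ric₂ inequality on all of `I`; and if `f`
is smooth on `I`, the family can be chosen `C²`-converging to `f` as `α → 0⁺`. -/
theorem main_smoothing (n : ℕ) (hn : 3 ≤ n) (t₀ : ℝ) (I : Set ℝ)
    (hIo : IsOpen I) (hIc : I.OrdConnected) (hII : Set.Icc (t₀ - 1) (t₀ + 1) ⊆ I)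
    (f : ℝ → ℝ)
    (hpos : ∀ t ∈ I, 0 < f t)
    (hC1 : ContDiffOn ℝ 1 f I)
    (han : AnalyticOnNhd ℝ f (I \ {t₀}))
    (hbd : ∃ M : ℝ, ∀ t ∈ Set.Ioo (t₀ - 1) t₀ ∪ Set.Ioo t₀ (t₀ + 1),
      |deriv (deriv f) t| ≤ M)
    (hric : ∀ t ∈ I \ {t₀}, deriv (deriv f) t <
      (1 - (deriv f t) ^ 2) / (((n : ℝ) / ((n : ℝ) - 2)) * f t)) :
    ∃ α₀ ∈ Set.Ioc (0 : ℝ) 1, ∃ F : ℝ → ℝ → ℝ,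
      (∀ α ∈ Set.Ioo (0 : ℝ) α₀,
        ContDiffOn ℝ (⊤ : ℕ∞) (F α) I ∧
        (∀ t ∈ I, 0 < F α t) ∧
        (∀ t ∈ I \ Set.Ioo (t₀ - α) (t₀ + α), F α t = f t) ∧
        (∀ t ∈ I, deriv (deriv (F α)) t <
          (1 - (deriv (F α) t) ^ 2) / (((n : ℝ) / ((n : ℝ) - 2)) * F α t))) ∧
      (ContDiffOn ℝ (⊤ : ℕ∞) f I → ∀ η > (0 : ℝ), ∃ α₁ ∈ Set.Ioc (0 : ℝ) α₀,
        ∀ α ∈ Set.Ioo (0 : ℝ) α₁, ∀ t ∈ I,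
          |F α t - f t| + |deriv (F α) t - deriv f t| +
            |deriv (deriv (F α)) t - deriv (deriv f) t| ≤ η) := by
  have hn2 : (0 : ℝ) < (n : ℝ) - 2 := by
    have : (3 : ℝ) ≤ n := by exact_mod_cast hn
    linarith
  have hn0 : (0 : ℝ) < n := by linarith
  set k : ℝ := (n : ℝ) / ((n : ℝ) - 2)
  have hk : 0 < k := by positivity
  have hIo' : IsOpen (I \ {t₀}) := hIo.sdiff isClosed_singleton
  have hf : ∀ t ∈ I, HasDerivAt f (deriv f t) t := fun t ht =>
    ((hC1.differentiableOn one_ne_zero).differentiableAt (hIo.mem_nhds ht)).hasDerivAt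
  have hfc : ContinuousOn f I := hC1.continuousOn
  have hf₁c : ContinuousOn (deriv f) I := hC1.continuousOn_deriv_of_isOpen hIo le_rfl
  have hf₁ : ∀ t ∈ I \ {t₀}, HasDerivAt (deriv f) (deriv (deriv f) t) t := fun t ht =>
    (han.deriv t ht).differentiableAt.hasDerivAt
  have hf₂ : ContDiffOn ℝ ∞ (deriv (deriv f)) (I \ {t₀}) :=
    han.deriv.deriv.contDiffOn hIo'.uniqueDiffOn
  obtain ⟨M, hM⟩ := hbd
  obtain ⟨M₀, hM₀⟩ := isCompact_Icc.exists_bound_of_continuousOn (hfc.mono hII)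
  obtain ⟨M₁, hM₁⟩ := isCompact_Icc.exists_bound_of_continuousOn (hf₁c.mono hII)
  obtain ⟨A, hA1, hA, hA₀, hA₁⟩ : ∃ A : ℝ, 1 ≤ A ∧ M ≤ A ∧ M₀ ≤ A ∧ M₁ ≤ A :=
    ⟨max 1 (max M (max M₀ M₁)), by simp, by simp, by simp, by simp⟩
  have hApos : 0 < A := by linarith
  obtain ⟨m, hm, hmf⟩ : ∃ m : ℝ, 0 < m ∧ ∀ t ∈ Set.Icc (t₀ - 1) (t₀ + 1), m ≤ f t := by
    obtain ⟨x, hx, hmin⟩ := isCompact_Icc.exists_isMinOn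
      (Set.nonempty_Icc.2 (by linarith : t₀ - 1 ≤ t₀ + 1)) (hfc.mono hII)
    exact ⟨f x, hpos x (hII hx), fun t ht => hmin ht⟩
  set L : ℝ := 4 * k * A + k + 2 * A + 1 with hL
  have hLpos : 0 < L := by positivity
  have key : ∀ α ∈ Set.Ioo (0 : ℝ) (min 1 (k * m / 2 / L)), ∃ F : ℝ → ℝ,
      (ContDiffOn ℝ ∞ F I ∧ (∀ t ∈ I, 0 < F t) ∧
        (∀ t ∈ I \ Set.Ioo (t₀ - α) (t₀ + α), F t = f t) ∧
        (∀ t ∈ I, deriv (deriv F) t < (1 - (deriv F t) ^ 2) / (k * F t))) ∧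
      (ContDiffOn ℝ ∞ f I → ∀ t ∈ I, |F t - f t| + |deriv F t - deriv f t| +
        |deriv (deriv F) t - deriv (deriv f) t| ≤ α) := by
    intro α hα
    have hα0 : 0 < α := hα.1
    have hα1 : α < 1 := hα.2.trans_le (min_le_left _ _)
    have hαL : α * L ≤ k * m / 2 := by
      rw [← le_div_iff₀ hLpos]; exact hα.2.le.trans (min_le_right _ _)
    obtain ⟨r, rfl⟩ : ∃ r, α = 4 * r := ⟨α / 4, by ring⟩
    have hr : 0 < r := by linarith
    have hsub : Set.Icc (t₀ - 2 * r) (t₀ + 2 * r) ⊆ Set.Icc (t₀ - 1) (t₀ + 1) :=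
      Set.Icc_subset_Icc (by linarith) (by linarith)
    have hsubI := hsub.trans hII
    have hbf : ∀ t ∈ Set.Icc (t₀ - 2 * r) (t₀ + 2 * r), |f t| ≤ A := fun t ht =>
      (hM₀ t (hsub ht)).trans hA₀
    have hbf₁ : ∀ t ∈ Set.Icc (t₀ - 2 * r) (t₀ + 2 * r), |deriv f t| ≤ A := fun t ht =>
      (hM₁ t (hsub ht)).trans hA₁
    have hbf₂ : ∀ t ∈ Set.Icc (t₀ - 2 * r) (t₀ + 2 * r), t ≠ t₀ → |deriv (deriv f) t| ≤ A := by
      intro t ht hne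
      refine (hM t ?_).trans hA
      rcases hne.lt_or_gt with h | h
      · exact Or.inl ⟨by linarith [ht.1], h⟩
      · exact Or.inr ⟨h, by linarith [ht.2]⟩
    obtain ⟨φ, hφ, hφ0, hφη, c, hc, hslack⟩ := exists_slack_perturbation (t₀ := t₀) (A := A)
      (η := min (m / 2) (4 * r / 3)) hk hr hm (by positivity) hA1 (hfc.mono hsubI)
      (hf₁c.mono hsubI) (hf₂.continuousOn.mono (Set.sdiff_subset_sdiff_left hsubI))
      hbf hbf₁ hbf₂ (fun t ht => hmf t (hsub ht)) (by linarith) (by nlinarith)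
      (fun t ht hne => by
        have h1 := hric t ⟨hsubI ht, hne⟩
        rw [lt_div_iff₀ (mul_pos hk (hpos t (hsubI ht)))] at h1
        linarith)
    have hφ' : ContDiff ℝ ∞ (deriv φ) := (contDiff_infty_iff_deriv.1 hφ).2
    have hφ'' : ContDiff ℝ ∞ (deriv (deriv φ)) := (contDiff_infty_iff_deriv.1 hφ').2
    have hφd : ∀ t, HasDerivAt φ (deriv φ t) t := fun t =>
      ((contDiff_infty_iff_deriv.1 hφ).1 t).hasDerivAt
    have hφd' : ∀ t, HasDerivAt (deriv φ) (deriv (deriv φ) t) t := fun t =>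
      ((contDiff_infty_iff_deriv.1 hφ').1 t).hasDerivAt
    have hg : ∀ t ∈ I, HasDerivAt (fun x => f x + φ x) (deriv f t + deriv φ t) t :=
      fun t ht => (hf t ht).add (hφd t)
    have hgeq : ∀ t ∈ I, t ∉ Set.Ioo (t₀ - 2 * r) (t₀ + 2 * r) → f t + φ t = f t := by
      intro t _ hn
      rw [hφ0 t, add_zero]
      by_contra! h
      rw [abs_lt] at h
      exact hn ⟨by linarith [h.1], by linarith [h.2]⟩
    have hgm : ∀ t ∈ Set.Icc (t₀ - 2 * r) (t₀ + 2 * r), m / 2 ≤ f t + φ t := fun t ht => by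
      have h1 := (abs_le.1 ((hφη t).1.trans (min_le_left _ _))).1
      linarith [hmf t (hsub ht)]
    by_cases hsm : ContDiffOn ℝ ∞ f I
    · have hsm₁ : ContDiffOn ℝ ∞ (deriv f) I :=
        ((contDiffOn_infty_iff_deriv_of_isOpen hIo).1 hsm).2
      obtain ⟨hdiff, hsm₂⟩ := (contDiffOn_infty_iff_deriv_of_isOpen hIo).1 hsm₁
      have hg₁ : ∀ t ∈ I, HasDerivAt (fun x => deriv f x + deriv φ x)
          (deriv (deriv f) t + deriv (deriv φ) t) t := fun t ht =>
        ((hdiff.differentiableAt (hIo.mem_nhds ht)).hasDerivAt).add (hφd' t)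
      refine ⟨fun t => f t + φ t, ricci_inequality_of_slack hIo hk (by linarith : 0 < 2 * r)
        (by linarith) hc hsubI hg hg₁ (hsm₂.add hφ''.contDiffOn) hgeq
        (fun t ht => by linarith [hgm t ht]) hslack hpos hric, fun _ t ht => ?_⟩
      rw [deriv_deriv_eq_of_hasDerivAt (F₂ := fun x => deriv (deriv f) x + deriv (deriv φ) x) hIo hg ht
        (hg₁ t ht), (hg t ht).deriv]
      simp only [add_sub_cancel_left]
      obtain ⟨h0, h1, h2⟩ := hφη t
      linarith [min_le_right (m / 2) (4 * r / 3)]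
    · have hη : min (m / 2) (4 * r / 3) ≤ 1 := (min_le_right _ _).trans (by linarith)
      obtain ⟨F, F₁, F₂, hF, hF₁, hF₂, heq, hFpos, hFs⟩ := exists_smoothing_of_slack
        (A := A + 1) (R := 2 * r) hIo hIc hII hg
        (hf₁c.add hφ'.continuous.continuousOn) (fun t ht => (hf₁ t ht).add (hφd' t))
        (hf₂.add hφ''.contDiffOn) (by linarith) hk (by linarith) (by linarith) hc
        (by linarith : 0 < m / 2)
        (fun t ht => (abs_add_le _ _).trans (add_le_add (hbf t ht) ((hφη t).1.trans hη)))
        (fun t ht => (abs_add_le _ _).trans (add_le_add (hbf₁ t ht) ((hφη t).2.1.trans hη)))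
        (fun t ht hne => (abs_add_le _ _).trans
          (add_le_add (hbf₂ t ht hne) ((hφη t).2.2.trans hη)))
        hgm hslack
      exact ⟨F, ricci_inequality_of_slack hIo hk (by linarith : 0 < 2 * r) (by linarith)
        (by linarith : 0 < c / 2) hsubI hF hF₁ hF₂
        (fun t ht hn => (heq t ht hn).trans (hgeq t ht hn)) hFpos hFs hpos hric,
        fun h => absurd h hsm⟩
  choose! F hF using key
  have hα₀ : 0 < min 1 (k * m / 2 / L) := by positivity
  refine ⟨min 1 (k * m / 2 / L), ⟨hα₀, min_le_left _ _⟩, F, fun α hα => (hF α hα).1,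
    fun hsm η hη => ⟨min η (min 1 (k * m / 2 / L)), ⟨by positivity, min_le_right _ _⟩,
      fun α hα t ht => ?_⟩⟩
  exact ((hF α ⟨hα.1, hα.2.trans_le (min_le_right _ _)⟩).2 hsm t ht).trans
    (hα.2.le.trans (min_le_left _ _))
end

section
/- Let n ≥ 3 be an integer, n̄ = n/(n−2), and let μ : [t₀,L] → (0,∞) be a smooth function with μ'(t) ∈ (−1,1) and μ''(t) < (1 − μ'(t)²)/(n̄·μ(t)) for all t ∈ [t₀,L]. Fix s ∈ (t₀,L). Set A = μ(s)/√(1−μ'(s)²), ω = √(1−μ'(s)²)/μ(s), φ₀ = arcsin(−μ'(s)), G(t) = A·cos(ω·(t−s) + φ₀), and let L_s = s + (π/2 − φ₀)/ω, the smallest t ≥ s with G(t) = 0. Then there exists α₀ ∈ (0, min{(s−t₀)/2, (L_s−s)/2}) such that for every α ∈ (0,α₀) there is a smooth function γ : [t₀, L_s] → ℝ satisfying: γ(t) = μ(t) for t ∈ [t₀, s−α]; γ(t) = G(t) for t ∈ [s+α, L_s]; γ(t) > 0 for t ∈ [t₀, L_s); γ(L_s) = 0; and γ''(t) < (1 − γ'(t)²)/(n̄·γ(t))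 for all t ∈ [t₀, L_s). -/
open Set Filter Topology

/-- The first two derivatives of `Real.smoothTransition` are bounded. -/
theorem exists_bound_deriv_smoothTransition : ∃ K : ℝ, 0 ≤ K ∧ ∀ x,
    |deriv Real.smoothTransition x| ≤ K ∧ |deriv (deriv Real.smoothTransition) x| ≤ K := by
  have h0 : ContDiff ℝ (⊤ : ℕ∞) Real.smoothTransition := Real.smoothTransition.contDiff
  have h1 := (contDiff_infty_iff_deriv.1 h0).2
  have h2 := (contDiff_infty_iff_deriv.1 h1).2
  obtain ⟨K₁, hK₁⟩ := (isCompact_Icc (a := (-1 : ℝ)) (b := 2)).exists_bound_of_continuousOn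
    h1.continuous.continuousOn
  obtain ⟨K₂, hK₂⟩ := (isCompact_Icc (a := (-1 : ℝ)) (b := 2)).exists_bound_of_continuousOn
    h2.continuous.continuousOn
  have hK : 0 ≤ max K₁ K₂ := (norm_nonneg _).trans ((hK₁ 0 (by norm_num)).trans (le_max_left _ _))
  have key : ∀ (x c : ℝ), Real.smoothTransition =ᶠ[𝓝 x] (fun _ => c) →
      |deriv Real.smoothTransition x| ≤ max K₁ K₂ ∧
      |deriv (deriv Real.smoothTransition) x| ≤ max K₁ K₂ := by
    intro x c h
    have h' := h.deriv
    rw [h.deriv_eq, h'.deriv_eq]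
    simpa using hK
  refine ⟨max K₁ K₂, hK, fun x => ?_⟩
  by_cases hx : x < -1
  · refine key x 0 ?_
    filter_upwards [Iio_mem_nhds (show x < 0 by linarith)] with y hy
    exact Real.smoothTransition.zero_of_nonpos (le_of_lt hy)
  by_cases hx' : 2 < x
  · refine key x 1 ?_
    filter_upwards [Ioi_mem_nhds (show 1 < x by linarith)] with y hy
    exact Real.smoothTransition.one_of_one_le (le_of_lt hy)
  have hm : x ∈ Icc (-1 : ℝ) 2 := ⟨not_lt.1 hx, not_lt.1 hx'⟩
  exact ⟨(hK₁ x hm).trans (le_max_left _ _), (hK₂ x hm).trans (le_max_right _ _)⟩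

/-- A smooth function vanishing to first order at `s` is quadratically small to the right
of `s`, and its derivative is linearly small. -/
theorem exists_bound_of_deriv_eq_zero {D : ℝ → ℝ} (hD : ContDiff ℝ (⊤ : ℕ∞) D) {s : ℝ}
    (h0 : D s = 0) (h1 : deriv D s = 0) :
    ∃ C : ℝ, 0 ≤ C ∧ ∀ t ∈ Icc s (s + 1),
      |D t| ≤ C * (t - s) ^ 2 ∧ |deriv D t| ≤ C * (t - s) := by
  have hd1 := contDiff_infty_iff_deriv.1 hD
  have hd2 := contDiff_infty_iff_deriv.1 hd1.2
  obtain ⟨C, hC⟩ := (isCompact_Icc (a := s) (b := s + 1)).exists_bound_of_continuousOn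
    hd2.2.continuous.continuousOn
  have hC0 : 0 ≤ C := (norm_nonneg _).trans (hC s ⟨le_rfl, by linarith⟩)
  have hb1 : ∀ t ∈ Icc s (s + 1), |deriv D t| ≤ C * (t - s) := by
    intro t ht
    have := (convex_Icc s (s + 1)).norm_image_sub_le_of_norm_deriv_le
      (fun x _ => hd2.1 x) hC ⟨le_rfl, by linarith⟩ ht
    simpa [h1, abs_of_nonneg (sub_nonneg.2 ht.1)] using this
  refine ⟨C, hC0, fun t ht => ⟨?_, hb1 t ht⟩⟩
  have := (convex_Icc s t).norm_image_sub_le_of_norm_deriv_le (C := C * (t - s))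
    (fun x _ => hd1.1 x)
    (fun x hx => (hb1 x ⟨hx.1, hx.2.trans ht.2⟩).trans
      (mul_le_mul_of_nonneg_left (by linarith [hx.2]) hC0)) ⟨le_rfl, ht.1⟩ ⟨ht.1, le_rfl⟩
  simp only [h0, sub_zero, Real.norm_eq_abs, abs_of_nonneg (sub_nonneg.2 ht.1)] at this
  linarith

/-- A first-order junction at `s` of two smooth functions can be smoothed so that the function
is, and its first two derivatives are up to an arbitrarily small error, pointwise convex
combinations of the given ones. The cutoff is a transition function on a logarithmic scale. -/
theorem exists_contDiff_junction {f g : ℝ → ℝ} (hf : ContDiff ℝ (⊤ : ℕ∞) f)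
    (hg : ContDiff ℝ (⊤ : ℕ∞) g) {s : ℝ} (h0 : f s = g s) (h1 : deriv f s = deriv g s)
    {ε : ℝ} (hε : 0 < ε) {α : ℝ} (hα : 0 < α) (hα1 : α ≤ 1) :
    ∃ γ : ℝ → ℝ, ContDiff ℝ (⊤ : ℕ∞) γ ∧
      (∀ t ≤ s, γ =ᶠ[𝓝 t] f) ∧ (∀ t, s + α ≤ t → γ =ᶠ[𝓝 t] g) ∧
      ∀ t ∈ Ioo s (s + α), ∃ θ ∈ Icc (0 : ℝ) 1,
        γ t = (1 - θ) * f t + θ * g t ∧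
        |deriv γ t - ((1 - θ) * deriv f t + θ * deriv g t)| < ε ∧
        |deriv (deriv γ) t - ((1 - θ) * deriv (deriv f) t + θ * deriv (deriv g) t)| < ε := by
  obtain ⟨K, hK0, hK⟩ := exists_bound_deriv_smoothTransition
  have hf1 := contDiff_infty_iff_deriv.1 hf
  have hg1 := contDiff_infty_iff_deriv.1 hg
  have hf2 := contDiff_infty_iff_deriv.1 hf1.2
  have hg2 := contDiff_infty_iff_deriv.1 hg1.2
  have hS : ContDiff ℝ (⊤ : ℕ∞) Real.smoothTransition := Real.smoothTransition.contDiff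
  have hS1 := contDiff_infty_iff_deriv.1 hS
  have hS2 := contDiff_infty_iff_deriv.1 hS1.2
  have hDd : ∀ t, HasDerivAt (fun x => g x - f x) (deriv g t - deriv f t) t := fun t =>
    (hg1.1 t).hasDerivAt.sub (hf1.1 t).hasDerivAt
  have hDd2 : ∀ t, HasDerivAt (fun x => deriv g x - deriv f x)
      (deriv (deriv g) t - deriv (deriv f) t) t := fun t =>
    (hg2.1 t).hasDerivAt.sub (hf2.1 t).hasDerivAt
  obtain ⟨C, hC0, hC⟩ := exists_bound_of_deriv_eq_zero (hg.sub hf) (s := s) (by simp [h0])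
    (by rw [(hDd s).deriv, h1, sub_self])
  obtain ⟨N, hN1, hN⟩ : ∃ N : ℝ, 1 ≤ N ∧ 4 * (K * C) / N < ε := by
    refine ⟨4 * (K * C) / ε + 1, ?_, ?_⟩
    · have : 0 ≤ 4 * (K * C) / ε := by positivity
      linarith
    · have : 0 ≤ 4 * (K * C) / ε := by positivity
      rw [div_lt_iff₀ (by linarith), mul_add, mul_div_cancel₀ _ hε.ne']
      linarith
  have hN0 : 0 < N := by linarith
  set u : ℝ → ℝ := fun t => 1 + Real.log ((t - s) / (α / 2)) / N with hu
  set γ : ℝ → ℝ := fun t =>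
    if t ≤ s then f t else f t + Real.smoothTransition (u t) * (g t - f t) with hγ
  have hleft : ∀ t, t < s + α / 2 * Real.exp (-N) → γ t = f t := by
    intro t ht
    by_cases hts : t ≤ s
    · simp [hγ, hts]
    · have hp : 0 < (t - s) / (α / 2) := div_pos (by linarith) (by linarith)
      have : Real.log ((t - s) / (α / 2)) ≤ -N := by
        rw [Real.log_le_iff_le_exp hp, div_le_iff₀ (by linarith)]
        linarith
      have : u t ≤ 0 := by
        have : Real.log ((t - s) / (α / 2)) / N ≤ -1 := by
          rw [div_le_iff₀ hN0]; linarith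
        simp only [hu]; linarith
      simp [hγ, Real.smoothTransition.zero_of_nonpos this]
  have hright : ∀ t, s + α / 2 < t → γ t = g t := by
    intro t ht
    have hts : ¬ t ≤ s := by linarith
    have : 1 ≤ u t := by
      have : 0 ≤ Real.log ((t - s) / (α / 2)) :=
        Real.log_nonneg (by rw [le_div_iff₀ (by linarith)]; linarith)
      simp only [hu]
      have := div_nonneg this hN0.le
      linarith
    simp [hγ, hts, Real.smoothTransition.one_of_one_le this]
  have hleft' : ∀ t, t < s + α / 2 * Real.exp (-N) → γ =ᶠ[𝓝 t] f := fun t ht => by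
    filter_upwards [Iio_mem_nhds ht] with x hx using hleft x hx
  have hmid : ∀ t, s < t → γ =ᶠ[𝓝 t]
      (fun t => f t + Real.smoothTransition (u t) * (g t - f t)) := fun t ht => by
    filter_upwards [Ioi_mem_nhds ht] with x hx
    simp [hγ, not_le.2 (mem_Ioi.1 hx)]
  have he : 0 < α / 2 * Real.exp (-N) := by positivity
  refine ⟨γ, ?_, fun t ht => hleft' t (by linarith), fun t ht => ?_, ?_⟩
  · rw [contDiff_iff_contDiffAt]
    intro t
    by_cases hts : t ≤ s
    · exact hf.contDiffAt.congr_of_eventuallyEq (hleft' t (by linarith))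
    · have hts : s < t := not_le.1 hts
      refine ContDiffAt.congr_of_eventuallyEq ?_ (hmid t hts)
      have hne : (t - s) / (α / 2) ≠ 0 := (div_pos (by linarith) (by linarith)).ne'
      have hut : ContDiffAt ℝ (⊤ : ℕ∞) u t :=
        contDiffAt_const.add (((((contDiffAt_id).sub contDiffAt_const).div_const _).log
          hne).div_const _)
      exact hf.contDiffAt.add ((hS.contDiffAt.comp t hut).mul (hg.contDiffAt.sub hf.contDiffAt))
  · filter_upwards [Ioi_mem_nhds (show s + α / 2 < t by linarith)] with x hx using hright x hx
  have hud : ∀ t, s < t → HasDerivAt u (1 / (N * (t - s))) t := by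
    intro t ht
    have hts : t - s ≠ 0 := by linarith [sub_pos.2 ht]
    have := ((((hasDerivAt_id t).sub_const s).div_const (α / 2)).log
      (div_pos (sub_pos.2 ht) (half_pos hα)).ne').div_const N |>.const_add 1
    have e : 1 / (N * (t - s)) = 1 / (α / 2) / ((t - s) / (α / 2)) / N := by field_simp
    rw [e]
    exact this
  have hd1 : ∀ t, s < t → HasDerivAt γ (deriv f t +
      (deriv Real.smoothTransition (u t) * (1 / (N * (t - s))) * (g t - f t) +
        Real.smoothTransition (u t) * (deriv g t - deriv f t))) t := by
    intro t ht
    refine HasDerivAt.congr_of_eventuallyEq ?_ (hmid t ht)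
    exact (hf1.1 t).hasDerivAt.add
      (((hS1.1 (u t)).hasDerivAt.comp t (hud t ht)).mul (hDd t))
  have hd2 : ∀ t, s < t → HasDerivAt (deriv γ) (deriv (deriv f) t +
      (((deriv (deriv Real.smoothTransition) (u t) * (1 / (N * (t - s)))) * (1 / (N * (t - s))) +
        deriv Real.smoothTransition (u t) * (-(N * 1) / (N * (t - s)) ^ 2)) * (g t - f t) +
       deriv Real.smoothTransition (u t) * (1 / (N * (t - s))) * (deriv g t - deriv f t) +
       (deriv Real.smoothTransition (u t) * (1 / (N * (t - s))) * (deriv g t - deriv f t) +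
        Real.smoothTransition (u t) * (deriv (deriv g) t - deriv (deriv f) t)))) t := by
    intro t ht
    have hts : N * (t - s) ≠ 0 := (mul_pos hN0 (sub_pos.2 ht)).ne'
    have hEq : deriv γ =ᶠ[𝓝 t] fun t => (deriv f t +
      (deriv Real.smoothTransition (u t) * (1 / (N * (t - s))) * (g t - f t) +
        Real.smoothTransition (u t) * (deriv g t - deriv f t))) := by
      filter_upwards [Ioi_mem_nhds ht] with x hx using (hd1 x hx).deriv
    refine HasDerivAt.congr_of_eventuallyEq ?_ hEq
    have hinv : HasDerivAt (fun t => 1 / (N * (t - s))) (-(N * 1) / (N * (t - s)) ^ 2) t := by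
      have := (((hasDerivAt_id t).sub_const s).const_mul N).inv hts
      simp only [one_div]
      exact this
    exact (hf2.1 t).hasDerivAt.add
      (((((hS2.1 (u t)).hasDerivAt.comp t (hud t ht)).mul hinv).mul (hDd t)).add
      (((hS1.1 (u t)).hasDerivAt.comp t (hud t ht)).mul (hDd2 t)))
  intro t ht
  obtain ⟨hst, hta⟩ := ht
  have hr : 0 < t - s := sub_pos.2 hst
  obtain ⟨hb0, hb1⟩ := hC t ⟨hst.le, by linarith⟩
  rw [(hDd t).deriv] at hb1
  obtain ⟨hk1, hk2⟩ := hK (u t)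
  obtain ⟨d₀, hd₀, hd₀'⟩ : ∃ d₀, g t - f t = d₀ * (t - s) ^ 2 ∧ |d₀| ≤ C := by
    refine ⟨(g t - f t) / (t - s) ^ 2, by field_simp, ?_⟩
    rw [abs_div, abs_of_pos (pow_pos hr 2), div_le_iff₀ (pow_pos hr 2)]
    exact hb0
  obtain ⟨d₁, hd₁, hd₁'⟩ : ∃ d₁, deriv g t - deriv f t = d₁ * (t - s) ∧ |d₁| ≤ C := by
    refine ⟨(deriv g t - deriv f t) / (t - s), by field_simp, ?_⟩
    rw [abs_div, abs_of_pos hr, div_le_iff₀ hr]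
    exact hb1
  have hKC : 0 ≤ K * C := mul_nonneg hK0 hC0
  have bound : ∀ a b w : ℝ, |a| ≤ K → |b| ≤ C → |w| ≤ 1 → |a * b * w / N| ≤ K * C / N := by
    intro a b w ha hb hw
    rw [abs_div, abs_of_pos hN0, abs_mul, abs_mul]
    refine div_le_div_of_nonneg_right ?_ hN0.le
    exact (mul_le_of_le_one_right (by positivity) hw).trans
      (mul_le_mul ha hb (abs_nonneg _) hK0)
  have hsplit : 4 * (K * C) / N = K * C / N + K * C / N + K * C / N + K * C / N := by ring
  refine ⟨Real.smoothTransition (u t), ⟨Real.smoothTransition.nonneg _,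
    Real.smoothTransition.le_one _⟩, ?_, ?_, ?_⟩
  · rw [(hmid t hst).eq_of_nhds]; ring
  · rw [(hd1 t hst).deriv]
    refine lt_of_le_of_lt ?_ hN
    have h := bound _ _ (t - s) hk1 hd₀' (by rw [abs_of_pos hr]; linarith)
    have e : ∀ a b d θ : ℝ, a + (b + θ * (d - a)) - ((1 - θ) * a + θ * d) = b := by
      intros; ring
    have e' : deriv Real.smoothTransition (u t) * (1 / (N * (t - s))) * (d₀ * (t - s) ^ 2) =
        deriv Real.smoothTransition (u t) * d₀ * (t - s) / N := by
      field_simp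
    rw [e, hd₀, e', hsplit]
    have := div_nonneg hKC hN0.le
    linarith
  · rw [(hd2 t hst).deriv]
    refine lt_of_le_of_lt ?_ hN
    have hNi : |1 / N| ≤ 1 := by
      rw [abs_of_pos (by positivity), div_le_one hN0]
      exact hN1
    have b₁ := abs_le.1 (bound _ _ (1 / N) hk2 hd₀' hNi)
    have b₂ := abs_le.1 (bound _ _ 1 hk1 hd₀' (by simp))
    have b₃ := abs_le.1 (bound _ _ 1 hk1 hd₁' (by simp))
    have e : ∀ a b d e θ : ℝ,
        a + (b + e + (e + θ * (d - a))) - ((1 - θ) * a + θ * d) = b + e + e := by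
      intros; ring
    have e₁ : (deriv (deriv Real.smoothTransition) (u t) * (1 / (N * (t - s))) *
          (1 / (N * (t - s))) +
        deriv Real.smoothTransition (u t) * (-(N * 1) / (N * (t - s)) ^ 2)) *
          (d₀ * (t - s) ^ 2) =
        deriv (deriv Real.smoothTransition) (u t) * d₀ * (1 / N) / N -
          deriv Real.smoothTransition (u t) * d₀ * 1 / N := by
      field_simp
      ring
    have e₂ : deriv Real.smoothTransition (u t) * (1 / (N * (t - s))) * (d₁ * (t - s)) =
        deriv Real.smoothTransition (u t) * d₁ * 1 / N := by
      field_simp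
    rw [e, hd₀, hd₁, e₁, e₂, hsplit, abs_le]
    constructor <;> linarith [b₁.1, b₁.2, b₂.1, b₂.2, b₃.1, b₃.2]

/-- The strict inequality `q < (1 - p²) / (c y)` with `0 < y` persists for nearby `(y, p)` and
smaller `q`. -/
theorem exists_box_lt_div {c y₀ p₀ B : ℝ} (hc : 0 < c) (hy₀ : 0 < y₀)
    (hB : B < (1 - p₀ ^ 2) / (c * y₀)) :
    ∃ δ > 0, ∀ y p, |y - y₀| < δ → |p - p₀| < δ → 0 < y ∧ B < (1 - p ^ 2) / (c * y) := by
  have h1 : ContinuousAt (fun z : ℝ × ℝ => (1 - z.2 ^ 2) / (c * z.1)) (y₀, p₀) := by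
    refine ContinuousAt.div (by fun_prop) (by fun_prop) ?_
    exact (mul_pos hc hy₀).ne'
  have h2 : ContinuousAt (fun z : ℝ × ℝ => z.1) (y₀, p₀) := by fun_prop
  have h3 := (h2.eventually (lt_mem_nhds hy₀)).and (h1.eventually (lt_mem_nhds hB))
  obtain ⟨δ, hδ, h⟩ := Metric.eventually_nhds_iff.1 h3
  refine ⟨δ, hδ, fun y p hy hp => ?_⟩
  exact h (y := (y, p)) (by
    rw [Prod.dist_eq, max_lt_iff]
    exact ⟨hy, hp⟩)

/-- A convex combination of two numbers close to `c` is close to `c`. -/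
theorem abs_convexComb_sub_lt {θ x y c δ : ℝ} (hθ : θ ∈ Icc (0 : ℝ) 1) (hx : |x - c| < δ)
    (hy : |y - c| < δ) : |(1 - θ) * x + θ * y - c| < δ := by
  obtain ⟨h0, h1⟩ := hθ
  rw [abs_lt] at hx hy ⊢
  constructor <;> rcases h0.eq_or_lt with rfl | h <;> nlinarith

/-- **Warped product deformation procedure.** A warping function `μ` satisfying the
strict Ric₂ inequality with `μ' ∈ (-1,1)` is truncated at `s` and capped off by the
explicit round cosine cap `G`, closing up at `L_s`; the `C¹` junction at `s` can be
smoothed over `(s-α, s+α)` for all sufficiently small `α`, preserving positivity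
(away from the closing point) and the Ric₂ inequality. -/
theorem warped_product_deformation (n : ℕ) (hn : 3 ≤ n) (t₀ L s : ℝ)
    (hs : s ∈ Set.Ioo t₀ L)
    (μ : ℝ → ℝ) (hμ : ContDiff ℝ (⊤ : ℕ∞) μ)
    (hpos : ∀ t ∈ Set.Icc t₀ L, 0 < μ t)
    (hder : ∀ t ∈ Set.Icc t₀ L, deriv μ t ∈ Set.Ioo (-1 : ℝ) 1)
    (hric : ∀ t ∈ Set.Icc t₀ L, deriv (deriv μ) t <
      (1 - (deriv μ t) ^ 2) / (((n : ℝ) / ((n : ℝ) - 2)) * μ t))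
    (A ω φ₀ Ls : ℝ) (G : ℝ → ℝ)
    (hA : A = μ s / Real.sqrt (1 - (deriv μ s) ^ 2))
    (hω : ω = Real.sqrt (1 - (deriv μ s) ^ 2) / μ s)
    (hφ : φ₀ = Real.arcsin (-(deriv μ s)))
    (hG : ∀ t, G t = A * Real.cos (ω * (t - s) + φ₀))
    (hLs : Ls = s + (Real.pi / 2 - φ₀) / ω) :
    ∃ α₀ : ℝ, 0 < α₀ ∧ α₀ < min ((s - t₀) / 2) ((Ls - s) / 2) ∧
      ∀ α ∈ Set.Ioo 0 α₀, ∃ γ : ℝ → ℝ, ContDiff ℝ (⊤ : ℕ∞) γ ∧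
        (∀ t ∈ Set.Icc t₀ (s - α), γ t = μ t) ∧
        (∀ t ∈ Set.Icc (s + α) Ls, γ t = G t) ∧
        (∀ t ∈ Set.Ico t₀ Ls, 0 < γ t) ∧ γ Ls = 0 ∧
        (∀ t ∈ Set.Ico t₀ Ls, deriv (deriv γ) t <
          (1 - (deriv γ t) ^ 2) / (((n : ℝ) / ((n : ℝ) - 2)) * γ t)) := by
  obtain ⟨hs0, hsL⟩ := hs
  have hsI : s ∈ Set.Icc t₀ L := ⟨hs0.le, hsL.le⟩
  have hm := hpos s hsI
  obtain ⟨hp1, hp2⟩ := hder s hsI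
  have hr := hric s hsI
  have hn' : (0 : ℝ) < (n : ℝ) / ((n : ℝ) - 2) := by
    have : (3 : ℝ) ≤ n := by exact_mod_cast hn
    exact div_pos (by linarith) (by linarith)
  set c : ℝ := (n : ℝ) / ((n : ℝ) - 2)
  have hq : 0 < 1 - (deriv μ s) ^ 2 := by nlinarith
  have hqs : 0 < Real.sqrt (1 - (deriv μ s) ^ 2) := Real.sqrt_pos.2 hq
  have hA0 : 0 < A := hA ▸ div_pos hm hqs
  have hω0 : 0 < ω := hω ▸ div_pos hqs hm
  have hAω : A * ω = 1 := by rw [hA, hω]; field_simp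
  have hφ1 : -(Real.pi / 2) < φ₀ := by
    rw [hφ, Real.neg_pi_div_two_lt_arcsin]; linarith
  have hφ2 : φ₀ < Real.pi / 2 := by
    rw [hφ, Real.arcsin_lt_pi_div_two]; linarith
  have hsin : Real.sin φ₀ = -deriv μ s := by
    rw [hφ, Real.sin_arcsin (by linarith) (by linarith)]
  have hcos : Real.cos φ₀ = Real.sqrt (1 - (deriv μ s) ^ 2) := by
    rw [hφ, Real.cos_arcsin, neg_sq]
  have hLs' : ω * (Ls - s) + φ₀ = Real.pi / 2 := by
    rw [hLs]; field_simp; ring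
  have hsLs : s < Ls := by
    rw [hLs]
    have := div_pos (sub_pos.2 hφ2) hω0
    linarith
  have hlin : ∀ t, HasDerivAt (fun t => ω * (t - s) + φ₀) ω t := fun t => by
    simpa using (((hasDerivAt_id t).sub_const s).const_mul ω).add_const φ₀
  have hGe : G = fun t => A * Real.cos (ω * (t - s) + φ₀) := funext hG
  have hGc : ContDiff ℝ (⊤ : ℕ∞) G := by rw [hGe]; fun_prop
  have hG1 : deriv G = fun t => -Real.sin (ω * (t - s) + φ₀) := by
    funext t
    rw [hGe, ((hlin t).cos.const_mul A).deriv]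
    linear_combination (-Real.sin (ω * (t - s) + φ₀)) * hAω
  have hG2 : ∀ t, deriv (deriv G) t = -(ω * Real.cos (ω * (t - s) + φ₀)) := by
    intro t
    rw [hG1]
    have := (hlin t).sin.neg.deriv
    rw [mul_comm] at this
    exact this
  have hGs : μ s = G s := by
    rw [hG, sub_self, mul_zero, zero_add, hcos, hA]; field_simp
  have hGs1 : deriv μ s = deriv G s := by
    simp [hG1, hsin]
  have hcospos : ∀ t, s ≤ t → t < Ls → 0 < Real.cos (ω * (t - s) + φ₀) := by
    intro t h1 h2
    refine Real.cos_pos_of_mem_Ioo ⟨?_, ?_⟩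
    · have := mul_nonneg hω0.le (sub_nonneg.2 h1)
      linarith
    · have := mul_lt_mul_of_pos_left (sub_lt_sub_right h2 s) hω0
      linarith
  have hGpos : ∀ t, s ≤ t → t < Ls → 0 < G t := fun t h1 h2 => by
    rw [hG]; exact mul_pos hA0 (hcospos t h1 h2)
  have hGric : ∀ t, s ≤ t → t < Ls → deriv (deriv G) t < (1 - (deriv G t) ^ 2) / (c * G t) := by
    intro t h1 h2
    have hc := hcospos t h1 h2
    have hneg : deriv (deriv G) t < 0 := by
      rw [hG2]; exact neg_neg_of_pos (mul_pos hω0 hc)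
    refine hneg.trans (div_pos ?_ (mul_pos hn' (hGpos t h1 h2)))
    simp only [hG1]
    nlinarith [Real.sin_sq_add_cos_sq (ω * (t - s) + φ₀), pow_pos hc 2]
  have hrG := hGric s le_rfl hsLs
  rw [← hGs, ← hGs1] at hrG
  obtain ⟨B, hB1, hB2⟩ := exists_between (max_lt hr hrG)
  obtain ⟨B', hB'1, hB'2⟩ := exists_between hB1
  obtain ⟨hB'μ, hB'G⟩ := max_lt_iff.1 hB'1
  obtain ⟨δ, hδ, hbox⟩ := exists_box_lt_div hn' hm hB2
  have hμ1 := (contDiff_infty_iff_deriv.1 hμ).2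
  have hμ2 := (contDiff_infty_iff_deriv.1 hμ1).2
  have hGc1 := (contDiff_infty_iff_deriv.1 hGc).2
  have hGc2 := (contDiff_infty_iff_deriv.1 hGc1).2
  have near : ∀ f : ℝ → ℝ, Continuous f → ∀ᶠ t in 𝓝 s, |f t - f s| < δ / 2 := fun f hf =>
    Metric.tendsto_nhds.1 (hf.tendsto s) (δ / 2) (half_pos hδ)
  have hev := ((near μ hμ.continuous).and (near G hGc.continuous)).and
    (((near _ hμ1.continuous).and (near _ hGc1.continuous)).and
    ((hμ2.continuous.continuousAt.eventually (gt_mem_nhds hB'μ)).and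
    (hGc2.continuous.continuousAt.eventually (gt_mem_nhds hB'G))))
  rw [← hGs, ← hGs1] at hev
  obtain ⟨ρ, hρ, hev⟩ := Metric.eventually_nhds_iff.1 hev
  have hM : 0 < min ((s - t₀) / 2) ((Ls - s) / 2) := lt_min (by linarith) (by linarith)
  refine ⟨min (min ((s - t₀) / 2) ((Ls - s) / 2) / 2) (min ρ 1), by positivity,
    (min_le_left _ _).trans_lt (half_lt_self hM), ?_⟩
  rintro α ⟨hα, hα'⟩
  obtain ⟨hα1, hα2, hα3⟩ : α < min ((s - t₀) / 2) ((Ls - s) / 2) / 2 ∧ α < ρ ∧ α < 1 := by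
    simpa only [lt_min_iff] using hα'
  have hαL : s + α < Ls := by
    have := min_le_right ((s - t₀) / 2) ((Ls - s) / 2)
    linarith
  obtain ⟨γ, hγ, hγl, hγr, hγm⟩ := exists_contDiff_junction hμ hGc hGs hGs1
    (lt_min (half_pos hδ) (sub_pos.2 hB'2)) hα hα3.le
  have hmid : ∀ t ∈ Set.Ioo s (s + α), 0 < γ t ∧
      deriv (deriv γ) t < (1 - (deriv γ t) ^ 2) / (c * γ t) := by
    intro t ht
    obtain ⟨θ, hθ, e0, e1, e2⟩ := hγm t ht
    obtain ⟨⟨n0, n0'⟩, ⟨n1, n1'⟩, n2, n2'⟩ := hev (y := t) (by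
      rw [Real.dist_eq, abs_of_pos (sub_pos.2 ht.1)]; linarith [ht.2])
    have b0 := abs_convexComb_sub_lt hθ n0 n0'
    have b1 := abs_convexComb_sub_lt hθ n1 n1'
    rw [← e0] at b0
    have d1 := e1.trans_le (min_le_left _ _)
    have d2 := e2.trans_le (min_le_right _ _)
    obtain ⟨p0, p1⟩ := hbox (γ t) (deriv γ t) (b0.trans (half_lt_self hδ)) (by
      rw [abs_lt] at b1 d1 ⊢
      constructor <;> linarith [b1.1, b1.2, d1.1, d1.2])
    refine ⟨p0, lt_trans ?_ p1⟩
    have := (abs_lt.1 d2).2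
    linarith [mul_le_mul_of_nonneg_left n2.le (sub_nonneg.2 hθ.2),
      mul_le_mul_of_nonneg_left n2'.le hθ.1]
  have hall : ∀ t ∈ Set.Ico t₀ Ls, 0 < γ t ∧
      deriv (deriv γ) t < (1 - (deriv γ t) ^ 2) / (c * γ t) := by
    rintro t ⟨ht0, htL⟩
    rcases le_or_gt t s with h | h
    · have e := hγl t h
      have ht : t ∈ Set.Icc t₀ L := ⟨ht0, h.trans hsL.le⟩
      rw [e.deriv.deriv_eq, e.deriv_eq, e.eq_of_nhds]
      exact ⟨hpos t ht, hric t ht⟩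
    rcases lt_or_ge t (s + α) with h' | h'
    · exact hmid t ⟨h, h'⟩
    · have e := hγr t h'
      rw [e.deriv.deriv_eq, e.deriv_eq, e.eq_of_nhds]
      exact ⟨hGpos t h.le htL, hGric t h.le htL⟩
  refine ⟨γ, hγ, fun t ht => (hγl t (by linarith [ht.2])).eq_of_nhds,
    fun t ht => (hγr t ht.1).eq_of_nhds, fun t ht => (hall t ht).1, ?_, fun t ht => (hall t ht).2⟩
  rw [(hγr Ls hαL.le).eq_of_nhds, hG, hLs', Real.cos_pi_div_two, mul_zero]
end
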